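/- arXiv:2112.06738 — 2 statements merged into one kernel-verified Lean document; each statement's English description precedes it below -/
import Mathlib

section
/- The S-module D_m is free, and it admits a free basis consisting of N homogeneous W-invariant vector fields L^{(1)},…,L^{(N)} whose degrees d_1,…,d_N satisfy Σ_{k=1}^N d_k = Σ_{H ∈ 𝒜} (m_H n_H + 1). (A vector field Σ f_i ∂_{x_i} is homogeneous of degree d if every nonzero f_i is homogeneous of degree d.) -/
open MvPolynomial

noncomputable section

/-- Action of a matrix `M` on polynomials by linear substitution of the variables. -/
def polyActM {N : ℕ} (M : Matrix (Fin N) (Fin N) ℂ) (p : MvPolynomial (Fin N) ℂ) :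
    MvPolynomial (Fin N) ℂ :=
  MvPolynomial.aeval (fun i => ∑ j, MvPolynomial.C (M i j) * MvPolynomial.X j) p

/-- Action of `g ∈ GL_N(ℂ)` on polynomials: `(g · p)(x) = p (g⁻¹ x)`. -/
def polyAct {N : ℕ} (g : Matrix.GeneralLinearGroup (Fin N) ℂ) (p : MvPolynomial (Fin N) ℂ) :
    MvPolynomial (Fin N) ℂ :=
  polyActM (↑(g⁻¹) : Matrix (Fin N) (Fin N) ℂ) p

/-- The linear polynomial with coefficient vector `a`. -/
def linPoly {N : ℕ} (a : Fin N → ℂ) : MvPolynomial (Fin N) ℂ :=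
  ∑ i, MvPolynomial.C (a i) * MvPolynomial.X i

/-- The polynomial vector field `L = Σ f_i ∂_i` applied to a polynomial. -/
def applyVF {N : ℕ} (f : Fin N → MvPolynomial (Fin N) ℂ) (p : MvPolynomial (Fin N) ℂ) :
    MvPolynomial (Fin N) ℂ :=
  ∑ i, f i * MvPolynomial.pderiv i p

/-- `g` is a (complex) reflection. -/
def IsReflection {N : ℕ} (g : Matrix.GeneralLinearGroup (Fin N) ℂ) : Prop :=
  ((↑g : Matrix (Fin N) (Fin N) ℂ) - 1).rank = 1

namespace ReflVF

/-- The polynomial ring `ℂ[x_1, …, x_N]`. -/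
abbrev Poly (N : ℕ) := MvPolynomial (Fin N) ℂ

variable {N : ℕ}

lemma linPoly_isHomogeneous (a : Fin N → ℂ) : (linPoly a).IsHomogeneous 1 := by
  refine IsHomogeneous.sum _ _ _ fun i _ => ?_
  simpa using (isHomogeneous_C _ (a i)).mul (isHomogeneous_X ℂ i)

lemma pderiv_linPoly (a : Fin N → ℂ) (j : Fin N) : pderiv j (linPoly a) = C (a j) := by
  classical
  simp [linPoly, Derivation.leibniz, pderiv_X, Pi.single_apply]

lemma linPoly_ne_zero {a : Fin N → ℂ} (ha : a ≠ 0) : linPoly a ≠ 0 := by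
  intro h
  apply ha
  ext j
  have := congrArg (pderiv j) h
  simpa [pderiv_linPoly] using this

lemma linPoly_smul (c : ℂ) (a : Fin N → ℂ) : linPoly (c • a) = C c * linPoly a := by
  simp [linPoly, Finset.mul_sum, mul_assoc]

lemma linPoly_prime {a : Fin N → ℂ} (ha : a ≠ 0) : Prime (linPoly a) := by
  classical
  obtain ⟨j, hj⟩ := Function.ne_iff.1 ha
  refine (irreducible_of_totalDegree_eq_one
    ((linPoly_isHomogeneous a).totalDegree (linPoly_ne_zero ha)) fun x hx => ?_).prime
  refine isUnit_iff_ne_zero.2 fun h0 => hj ?_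
  have := hx (Finsupp.single j 1)
  rw [h0, zero_dvd_iff] at this
  simpa [linPoly, coeff_sum, coeff_C_mul, coeff_X, Finsupp.single_left_inj] using this

lemma homogeneousComponent_mul {m : ℕ} {p : Poly N} (hp : p.IsHomogeneous m) (i : ℕ)
    (q : Poly N) : homogeneousComponent (m + i) (p * q) = p * homogeneousComponent i q := by
  conv_lhs => rw [← sum_homogeneousComponent q, Finset.mul_sum, map_sum]
  have : ∀ j, homogeneousComponent (m + i) (p * homogeneousComponent j q) =
      if i = j then p * homogeneousComponent i q else 0 := by
    intro j
    rw [homogeneousComponent_of_mem (hp.mul (homogeneousComponent_isHomogeneous j q))]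
    by_cases h : i = j
    · subst h; simp
    · rw [if_neg h, if_neg (by omega)]
  simp only [this, Finset.sum_ite_eq, Finset.mem_range]
  split_ifs with h
  · rfl
  · rw [homogeneousComponent_eq_zero _ _ (by omega), mul_zero]

lemma homogeneousComponent_mul_of_lt {m k : ℕ} {p : Poly N} (hp : p.IsHomogeneous m) (hk : k < m)
    (q : Poly N) : homogeneousComponent k (p * q) = 0 := by
  conv_lhs => rw [← sum_homogeneousComponent q, Finset.mul_sum, map_sum]
  refine Finset.sum_eq_zero fun j _ => ?_
  rw [homogeneousComponent_of_mem (hp.mul (homogeneousComponent_isHomogeneous j q)),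
    if_neg (by omega)]

lemma eq_of_homogeneousComponent {p q : Poly N}
    (h : ∀ i, homogeneousComponent i p = homogeneousComponent i q) : p = q := by
  ext d
  have := congrArg (coeff d) (h d.degree)
  simpa [coeff_homogeneousComponent] using this

lemma le_of_isHomogeneous_mul {m k : ℕ} {p q : Poly N} (hp : p.IsHomogeneous m) (hp0 : p ≠ 0)
    (hq0 : q ≠ 0) (h : (p * q).IsHomogeneous k) : m ≤ k := by
  rw [← h.totalDegree (mul_ne_zero hp0 hq0), totalDegree_mul_of_isDomain hp0 hq0,
    hp.totalDegree hp0]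
  omega

lemma isHomogeneous_of_mul {m k : ℕ} {p q : Poly N} (hp : p.IsHomogeneous m) (hp0 : p ≠ 0)
    (h : (p * q).IsHomogeneous k) : q.IsHomogeneous (k - m) := by
  by_cases hq0 : q = 0
  · rw [hq0]; exact isHomogeneous_zero _ _ _
  have hmk := le_of_isHomogeneous_mul hp hp0 hq0 h
  have : homogeneousComponent (k - m) q = q := by
    apply mul_left_cancel₀ hp0
    rw [← homogeneousComponent_mul hp, Nat.add_sub_cancel' hmk, homogeneousComponent_eq_self h]
  rw [← this]
  exact homogeneousComponent_isHomogeneous _ _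

lemma totalDegree_pderiv_le (j : Fin N) (p : Poly N) :
    (pderiv j p).totalDegree ≤ p.totalDegree - 1 := by
  conv_lhs => rw [← sum_homogeneousComponent p, map_sum]
  refine totalDegree_finsetSum_le fun i hi => ?_
  refine ((homogeneousComponent_isHomogeneous i p).pderiv (i := j)).totalDegree_le.trans ?_
  have := Finset.mem_range.1 hi
  omega

lemma eq_C_of_pderiv_eq_zero {p : Poly N} (h : ∀ j, pderiv j p = 0) : p = C (coeff 0 p) := by
  rw [← homogeneousComponent_zero]
  refine eq_of_homogeneousComponent fun i => ?_
  rcases Nat.eq_zero_or_pos i with rfl | hi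
  · exact (homogeneousComponent_eq_self (homogeneousComponent_isHomogeneous _ _)).symm
  · rw [homogeneousComponent_of_mem (homogeneousComponent_isHomogeneous 0 p), if_neg hi.ne']
    ext d
    rw [coeff_homogeneousComponent]
    split_ifs with hd
    · have : d ≠ 0 := by rintro rfl; simp at hd; omega
      obtain ⟨j, hj⟩ := Finsupp.ne_iff.1 this
      have h1 := coeff_pderiv (i := j) p (d - Finsupp.single j 1)
      rw [h j, tsub_add_cancel_of_le (by simpa [Nat.one_le_iff_ne_zero] using hj)] at h1
      rw [coeff_zero] at h1
      rcases mul_eq_zero.1 h1.symm with h2 | h2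
      · simpa using h2
      · norm_cast at h2
    · simp

/-- If the annihilator of a family of polynomial vectors is stable under differentiation, then
a nonzero annihilator can be replaced by a constant one. -/
lemma exists_const_annihilator {κ θ : Type*} [Fintype κ] (F : θ → κ → Poly N)
    (hF : ∀ lam : κ → Poly N, (∀ t, ∑ k, lam k * F t k = 0) →
      ∀ t j, ∑ k, lam k * pderiv j (F t k) = 0)
    (lam : κ → Poly N) (h0 : lam ≠ 0) (hlam : ∀ t, ∑ k, lam k * F t k = 0) :
    ∃ mu : κ → ℂ, mu ≠ 0 ∧ ∀ t, ∑ k, C (mu k) * F t k = 0 := by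
  obtain ⟨n, hn⟩ : ∃ n, ∀ k, (lam k).totalDegree ≤ n :=
    ⟨∑ k, (lam k).totalDegree, fun k =>
      Finset.single_le_sum (f := fun k => (lam k).totalDegree) (fun _ _ => Nat.zero_le _)
        (Finset.mem_univ k)⟩
  have const : ∀ lam : κ → Poly N, lam ≠ 0 → (∀ t, ∑ k, lam k * F t k = 0) →
      (∀ k, lam k = C (coeff 0 (lam k))) →
      ∃ mu : κ → ℂ, mu ≠ 0 ∧ ∀ t, ∑ k, C (mu k) * F t k = 0 := by
    intro lam h0 hlam hc
    refine ⟨fun k => coeff 0 (lam k), fun h => h0 ?_, fun t => ?_⟩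
    · ext1 k
      rw [hc k, show coeff 0 (lam k) = 0 from congrFun h k]; simp
    · simpa only [← hc] using hlam t
  induction n generalizing lam with
  | zero =>
    exact const lam h0 hlam fun k => totalDegree_eq_zero_iff_eq_C.1 (Nat.le_zero.1 (hn k))
  | succ n ih =>
    by_cases hd : ∀ j k, pderiv j (lam k) = 0
    · exact const lam h0 hlam fun k => eq_C_of_pderiv_eq_zero fun j => hd j k
    · push Not at hd
      obtain ⟨j, k, hjk⟩ := hd
      refine ih (fun k => pderiv j (lam k)) (fun h => hjk (congrFun h k)) (fun t => ?_)
        fun k => (totalDegree_pderiv_le j _).trans (by have := hn k; omega)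
      have h1 := congrArg (pderiv j) (hlam t)
      simp only [map_sum, Derivation.leibniz, smul_eq_mul, map_zero, Finset.sum_add_distrib,
        hF lam hlam t j, zero_add] at h1
      simpa only [mul_comm] using h1

end ReflVF

namespace ReflVF

/-- A finite reflection group `G → GL_N(ℂ)` with linear forms defining its hyperplanes, the
pointwise stabilizers of the hyperplanes and an invariant multiplicity function. -/
structure ReflData (N : ℕ) (G A : Type) [Group G] where
  V : G →* Matrix (Fin N) (Fin N) ℂ
  α : A → Fin N → ℂ
  α_ne : ∀ H, α H ≠ 0
  distinct : ∀ H H', (∃ c : ℂ, α H' = c • α H) → H = H'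
  stab : A → Subgroup G
  mem_stab : ∀ H s, s ∈ stab H ↔ ∃ b, V s = 1 + Matrix.vecMulVec b (α H)
  m : A → ℕ
  perm : ∀ g H, ∃ H' c, c ≠ 0 ∧ α H' = (c : ℂ) • Matrix.vecMul (α H) (V g⁻¹) ∧ m H' = m H
  refl : ∀ H, ∃ s ∈ stab H, (V s).det ≠ 1
  gen : Subgroup.closure {s | ∃ H, s ∈ stab H} = ⊤
  irr : ∀ U : Submodule ℂ (Fin N → ℂ), (∀ g, ∀ v ∈ U, (V g).mulVec v ∈ U) → U = ⊥ ∨ U = ⊤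

variable {N : ℕ} {G A : Type} [Group G]

lemma polyActM_mul (M M' : Matrix (Fin N) (Fin N) ℂ) (p : Poly N) :
    polyActM (M * M') p = polyActM M' (polyActM M p) := by
  have h : (aeval (fun i => ∑ j, C ((M * M') i j) * X j) : Poly N →ₐ[ℂ] Poly N) =
      (aeval (fun i => ∑ j, C (M' i j) * X j)).comp (aeval (fun i => ∑ j, C (M i j) * X j)) := by
    apply algHom_ext
    intro i
    simp only [Matrix.mul_apply, aeval_X, AlgHom.comp_apply, map_sum, map_mul, ← algebraMap_eq,
      AlgHom.commutes, Finset.sum_mul, Finset.mul_sum]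
    rw [Finset.sum_comm]
    simp only [mul_assoc]
  exact DFunLike.congr_fun h p

lemma polyActM_one (p : Poly N) : polyActM 1 p = p := by
  classical
  unfold polyActM
  simp [Matrix.one_apply]

lemma polyActM_linPoly (M : Matrix (Fin N) (Fin N) ℂ) (a : Fin N → ℂ) :
    polyActM M (linPoly a) = linPoly (Matrix.vecMul a M) := by
  simp only [polyActM, linPoly, map_sum, map_mul, aeval_X, ← algebraMap_eq, AlgHom.commutes,
    Matrix.vecMul, dotProduct, Finset.sum_mul, Finset.mul_sum]
  rw [Finset.sum_comm]
  simp only [mul_assoc]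

lemma polyActM_isHomogeneous (M : Matrix (Fin N) (Fin N) ℂ) {p : Poly N} {k : ℕ}
    (hp : p.IsHomogeneous k) : (polyActM M p).IsHomogeneous k := by
  have := hp.aeval (n := 1) (fun i => ∑ j, C (M i j) * X j : Fin N → Poly N)
    (fun i => linPoly_isHomogeneous (M i))
  simpa [polyActM] using this

namespace ReflData

variable (D : ReflData N G A)

/-- The action of `G` on polynomials. -/
def act : G →* (Poly N →ₐ[ℂ] Poly N) where
  toFun g := aeval (fun i => ∑ j, C (D.V g⁻¹ i j) * X j)
  map_one' := by
    apply AlgHom.ext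
    intro p
    rw [inv_one, map_one]
    exact polyActM_one p
  map_mul' g h := by
    apply AlgHom.ext
    intro p
    rw [mul_inv_rev, map_mul]
    exact polyActM_mul _ _ p

lemma act_apply (g : G) (p : Poly N) : D.act g p = polyActM (D.V g⁻¹) p := rfl

lemma act_mul_apply (g h : G) (p : Poly N) : D.act (g * h) p = D.act g (D.act h p) := by
  rw [map_mul]; rfl

lemma act_one_apply (p : Poly N) : D.act 1 p = p := by
  rw [map_one]; rfl

@[simp] lemma act_C (g : G) (c : ℂ) : D.act g (C c) = C c := (D.act g).commutes c

lemma act_injective (g : G) : Function.Injective (D.act g) := by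
  intro p q h
  have := congrArg (D.act g⁻¹) h
  simpa only [← act_mul_apply, inv_mul_cancel, act_one_apply] using this

lemma act_isHomogeneous (g : G) {p : Poly N} {k : ℕ} (hp : p.IsHomogeneous k) :
    (D.act g p).IsHomogeneous k := polyActM_isHomogeneous _ hp

lemma homogeneousComponent_act (g : G) (k : ℕ) (p : Poly N) :
    homogeneousComponent k (D.act g p) = D.act g (homogeneousComponent k p) := by
  conv_lhs => rw [← sum_homogeneousComponent p, map_sum, map_sum]
  have : ∀ j, homogeneousComponent k (D.act g (homogeneousComponent j p)) =
      if k = j then D.act g (homogeneousComponent k p) else 0 := by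
    intro j
    rw [homogeneousComponent_of_mem
      (D.act_isHomogeneous g (homogeneousComponent_isHomogeneous j p))]
    by_cases h : k = j
    · subst h; simp
    · rw [if_neg h, if_neg h]
  simp only [this, Finset.sum_ite_eq, Finset.mem_range]
  split_ifs with h
  · rfl
  · rw [homogeneousComponent_eq_zero _ _ (by omega), map_zero]

lemma totalDegree_act_le (g : G) (p : Poly N) : (D.act g p).totalDegree ≤ p.totalDegree := by
  conv_lhs => rw [← sum_homogeneousComponent p, map_sum]
  refine totalDegree_finsetSum_le fun i hi => ?_
  refine (D.act_isHomogeneous g (homogeneousComponent_isHomogeneous i p)).totalDegree_le.trans ?_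
  have := Finset.mem_range.1 hi
  omega

/-- The linear form of the hyperplane `H`. -/
def ℓ (H : A) : Poly N := linPoly (D.α H)

/-- The determinant character. -/
def χ (g : G) : ℂ := (D.V g).det

lemma χ_mul (g h : G) : D.χ (g * h) = D.χ g * D.χ h := by simp [χ]

lemma χ_one : D.χ 1 = 1 := by simp [χ]

lemma χ_ne_zero (g : G) : D.χ g ≠ 0 := by
  intro h
  have := D.χ_mul g g⁻¹
  rw [mul_inv_cancel, χ_one, h, zero_mul] at this
  exact one_ne_zero this

lemma χ_inv (g : G) : D.χ g⁻¹ = (D.χ g)⁻¹ := by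
  have := D.χ_mul g⁻¹ g
  rw [inv_mul_cancel, χ_one] at this
  exact eq_inv_of_mul_eq_one_left this.symm

/-- The order of the pointwise stabilizer of `H`. -/
def n (H : A) : ℕ := Nat.card (D.stab H)

/-- The exponent `m_H n_H`. -/
def a (H : A) : ℕ := D.m H * D.n H

lemma n_pos [Finite G] (H : A) : 0 < D.n H := Nat.card_pos

lemma χ_pow_n {H : A} {s : G} (hs : s ∈ D.stab H) : D.χ s ^ D.n H = 1 := by
  have h1 : s ^ D.n H = 1 := by
    exact congrArg Subtype.val (pow_card_eq_one' (G := D.stab H) (x := ⟨s, hs⟩))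
  have h2 : ∀ k, D.χ s ^ k = D.χ (s ^ k) := by
    intro k
    simp [χ]
  rw [h2, h1, χ_one]

lemma χ_pow_a {H : A} {s : G} (hs : s ∈ D.stab H) : D.χ s ^ D.a H = 1 := by
  rw [a, mul_comm, pow_mul, D.χ_pow_n hs, one_pow]

lemma ℓ_isHomogeneous (H : A) : (D.ℓ H).IsHomogeneous 1 := linPoly_isHomogeneous _

lemma ℓ_ne_zero (H : A) : D.ℓ H ≠ 0 := linPoly_ne_zero (D.α_ne H)

lemma ℓ_prime (H : A) : Prime (D.ℓ H) := linPoly_prime (D.α_ne H)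

lemma pderiv_ℓ (j : Fin N) (H : A) : pderiv j (D.ℓ H) = C (D.α H j) := pderiv_linPoly _ _

lemma not_ℓ_dvd {H H' : A} (h : H ≠ H') : ¬ D.ℓ H ∣ D.ℓ H' := by
  rintro ⟨q, hq⟩
  have hq0 : q ≠ 0 := by
    rintro rfl
    exact D.ℓ_ne_zero H' (by simpa using hq)
  have h1 := isHomogeneous_of_mul (D.ℓ_isHomogeneous H) (D.ℓ_ne_zero H)
    (hq ▸ D.ℓ_isHomogeneous H')
  have h2 := totalDegree_eq_zero_iff_eq_C.1 (h1.totalDegree hq0)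
  refine h (D.distinct _ _ ⟨coeff 0 q, ?_⟩)
  ext j
  have h3 := congrArg (pderiv j) hq
  rw [h2, mul_comm, pderiv_C_mul, pderiv_ℓ, pderiv_ℓ, ← C_mul] at h3
  exact C_injective _ _ h3

lemma dvd_of_dvd_mul_ℓ {H H' : A} (h : H ≠ H') {k : ℕ} {p : Poly N}
    (hp : D.ℓ H ^ k ∣ D.ℓ H' * p) : D.ℓ H ^ k ∣ p :=
  (D.ℓ_prime H).pow_dvd_of_dvd_mul_left k (D.not_ℓ_dvd h) hp

lemma isRelPrime_pow {H H' : A} (h : H ≠ H') (k k' : ℕ) :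
    IsRelPrime (D.ℓ H ^ k) (D.ℓ H' ^ k') := by
  have : IsRelPrime (D.ℓ H) (D.ℓ H') :=
    ((D.ℓ_prime H).irreducible.isRelPrime_iff_not_dvd).2 (D.not_ℓ_dvd h)
  exact this.pow

lemma prod_dvd [Fintype A] (k : A → ℕ) {p : Poly N} (h : ∀ H, D.ℓ H ^ k H ∣ p) :
    ∏ H, D.ℓ H ^ k H ∣ p :=
  Fintype.prod_dvd_of_isRelPrime (fun _ _ hne => D.isRelPrime_pow hne _ _) h

lemma vecMul_V {H : A} {s : G} (hs : s ∈ D.stab H) :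
    Matrix.vecMul (D.α H) (D.V s) = D.χ s • D.α H := by
  obtain ⟨b, hb⟩ := (D.mem_stab H s).1 hs
  have hdet : D.χ s = 1 + dotProduct (D.α H) b := by
    rw [χ, hb, Matrix.vecMulVec_eq Unit, Matrix.det_one_add_replicateCol_mul_replicateRow]
  rw [hdet, hb, Matrix.vecMul_add, Matrix.vecMul_one, Matrix.vecMul_vecMulVec, add_smul, one_smul]

lemma act_ℓ {H : A} {s : G} (hs : s ∈ D.stab H) :
    D.act s (D.ℓ H) = C (D.χ s)⁻¹ * D.ℓ H := by
  rw [act_apply, ℓ, polyActM_linPoly, D.vecMul_V (inv_mem hs), χ_inv, linPoly_smul]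

lemma act_ℓ_pow_a {H : A} {s : G} (hs : s ∈ D.stab H) :
    D.act s (D.ℓ H ^ D.a H) = D.ℓ H ^ D.a H := by
  rw [map_pow, D.act_ℓ hs, mul_pow, ← C_pow, inv_pow, D.χ_pow_a hs, inv_one, C_1, one_mul]

lemma ℓ_dvd_act_sub {H : A} {s : G} (hs : s ∈ D.stab H) (p : Poly N) :
    D.ℓ H ∣ D.act s p - p := by
  obtain ⟨b, hb⟩ := (D.mem_stab H s⁻¹).1 (inv_mem hs)
  rw [← Ideal.mem_span_singleton, ← Ideal.Quotient.eq]
  let π := Ideal.Quotient.mkₐ ℂ (Ideal.span {D.ℓ H})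
  change (π.comp (D.act s)) p = π p
  congr 1
  apply algHom_ext
  intro i
  change Ideal.Quotient.mk _ _ = Ideal.Quotient.mk _ _
  rw [Ideal.Quotient.eq, Ideal.mem_span_singleton]
  refine ⟨C (b i), ?_⟩
  change aeval _ (X i) - _ = _
  rw [aeval_X, hb]
  classical
  simp [Matrix.vecMulVec_apply, Matrix.one_apply, ite_mul, add_mul, Finset.sum_add_distrib, ℓ,
    linPoly, Finset.sum_mul]
  exact Finset.sum_congr rfl fun j _ => by ring

lemma exists_perm (g : G) (H : A) : ∃ H' c, c ≠ 0 ∧ D.act g (D.ℓ H) = C c * D.ℓ H' ∧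
    D.a H' = D.a H ∧ ∀ s, s ∈ D.stab H ↔ g * s * g⁻¹ ∈ D.stab H' := by
  obtain ⟨H', c, hc, hα, hm⟩ := D.perm g H
  have hα' : Matrix.vecMul (D.α H) (D.V g⁻¹) = c⁻¹ • D.α H' := by
    rw [hα, smul_smul, inv_mul_cancel₀ hc, one_smul]
  have hgg : D.V g * D.V g⁻¹ = 1 := by rw [← map_mul, mul_inv_cancel, map_one]
  have hgg' : D.V g⁻¹ * D.V g = 1 := by rw [← map_mul, inv_mul_cancel, map_one]
  have hα'' : Matrix.vecMul (D.α H') (D.V g) = c • D.α H := by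
    rw [hα, Matrix.smul_vecMul, Matrix.vecMul_vecMul, hgg', Matrix.vecMul_one]
  have hst : ∀ s, s ∈ D.stab H ↔ g * s * g⁻¹ ∈ D.stab H' := by
    intro s
    rw [D.mem_stab, D.mem_stab]
    constructor
    · rintro ⟨b, hb⟩
      refine ⟨c⁻¹ • (D.V g).mulVec b, ?_⟩
      rw [map_mul, map_mul, hb, mul_add, add_mul, mul_one, hgg, Matrix.mul_vecMulVec,
        Matrix.vecMulVec_mul, hα', Matrix.vecMulVec_smul, Matrix.smul_vecMulVec]
    · rintro ⟨b, hb⟩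
      refine ⟨c • (D.V g⁻¹).mulVec b, ?_⟩
      have : D.V s = D.V g⁻¹ * D.V (g * s * g⁻¹) * D.V g := by
        rw [← map_mul, ← map_mul]; congr 1; group
      rw [this, hb, mul_add, add_mul, mul_one, hgg', Matrix.mul_vecMulVec,
        Matrix.vecMulVec_mul, hα'', Matrix.vecMulVec_smul, Matrix.smul_vecMulVec]
  refine ⟨H', c⁻¹, inv_ne_zero hc, ?_, ?_, hst⟩
  · rw [act_apply, ℓ, polyActM_linPoly, hα', linPoly_smul, ℓ]
  · rw [a, a, hm]
    congr 1
    have : (D.stab H').comap (MulAut.conj g).toMonoidHom = D.stab H := by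
      ext s
      rw [hst s]
      rfl
    rw [n, n, ← this]
    refine (Nat.card_congr (Equiv.subtypeEquiv (MulAut.conj g).toEquiv fun s => ?_)).symm
    rfl

end ReflData

end ReflVF

namespace ReflVF

open scoped Classical

variable {N : ℕ} {G A : Type} [Group G] [Fintype G]
variable {κ κ' κ'' : Type} [Fintype κ] [Fintype κ'] [Fintype κ''] [DecidableEq κ] [DecidableEq κ']

set_option linter.unusedSectionVars false

/-- A constant matrix acting on vectors of polynomials. -/
def cmul (B : Matrix κ' κ ℂ) : (κ → Poly N) →ₗ[Poly N] (κ' → Poly N) :=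
  Matrix.mulVecLin (B.map C)

lemma cmul_apply (B : Matrix κ' κ ℂ) (f : κ → Poly N) (k : κ') :
    cmul B f k = ∑ j, C (B k j) * f j := rfl

lemma cmul_mul (B : Matrix κ'' κ' ℂ) (B' : Matrix κ' κ ℂ) (f : κ → Poly N) :
    cmul (B * B') f = cmul B (cmul B' f) := by
  simp [cmul, Matrix.map_mul, Matrix.mulVec_mulVec]

lemma cmul_one (f : κ → Poly N) : cmul 1 f = f := by
  rw [cmul, Matrix.map_one _ C_0 C_1]
  simp

lemma cmul_add_left (B B' : Matrix κ' κ ℂ) (f : κ → Poly N) :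
    cmul (B + B') f = cmul B f + cmul B' f := by
  ext1 k
  simp [cmul_apply, add_mul, Finset.sum_add_distrib]

lemma cmul_smul_left (c : ℂ) (B : Matrix κ' κ ℂ) (f : κ → Poly N) :
    cmul (c • B) f = (C c : Poly N) • cmul B f := by
  ext1 k
  simp [cmul_apply, Finset.mul_sum, mul_assoc]

lemma cmul_sum_left {ι : Type} (s : Finset ι) (B : ι → Matrix κ' κ ℂ) (f : κ → Poly N) :
    cmul (∑ i ∈ s, B i) f = ∑ i ∈ s, cmul (B i) f := by
  ext1 k
  simp only [cmul_apply, Finset.sum_apply, Matrix.sum_apply, map_sum, Finset.sum_mul]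
  rw [Finset.sum_comm]

lemma cmul_isHomogeneous {d : ℕ} (B : Matrix κ' κ ℂ) {f : κ → Poly N}
    (hf : ∀ k, (f k).IsHomogeneous d) (k : κ') : (cmul B f k).IsHomogeneous d := by
  refine IsHomogeneous.sum _ _ _ fun j _ => ?_
  simpa using (isHomogeneous_C _ (B k j)).mul (hf j)

lemma C_smul_eq {κ : Type} (c : ℂ) (f : κ → Poly N) : (C c : Poly N) • f = c • f := by
  ext1 k
  exact (smul_eq_C_mul (f k) c).symm

lemma exists_eq_smul_iff {κ : Type} {p : Poly N} {f : κ → Poly N} :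
    (∃ u : κ → Poly N, f = p • u) ↔ ∀ k, p ∣ f k := by
  constructor
  · rintro ⟨u, rfl⟩ k
    exact ⟨u k, rfl⟩
  · intro h
    choose u hu using h
    exact ⟨u, funext hu⟩

namespace ReflData

variable (D : ReflData N G A) (ρ : G →* Matrix κ κ ℂ)

/-- The action of `G` on the coordinates of a vector of polynomials. -/
def actv (κ : Type) (g : G) : (κ → Poly N) →ₗ[ℂ] (κ → Poly N) where
  toFun f k := D.act g (f k)
  map_add' f f' := by ext1 k; simp
  map_smul' c f := by ext1 k; simp

omit [Fintype G] in
lemma actv_apply (g : G) (f : κ → Poly N) (k : κ) : D.actv κ g f k = D.act g (f k) := rfl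

omit [Fintype G] in
lemma actv_smul (g : G) (p : Poly N) (f : κ → Poly N) :
    D.actv κ g (p • f) = D.act g p • D.actv κ g f := by
  ext1 k
  simp [actv_apply]

omit [Fintype G] in
lemma actv_cmul (g : G) (B : Matrix κ' κ ℂ) (f : κ → Poly N) :
    D.actv κ' g (cmul B f) = cmul B (D.actv κ g f) := by
  ext1 k
  simp [actv_apply, cmul_apply]

/-- The diagonal action of `G` on vectors of polynomials. -/
def gact (g : G) : (κ → Poly N) →ₗ[ℂ] (κ → Poly N) :=
  (cmul (ρ g)).restrictScalars ℂ ∘ₗ D.actv κ g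

omit [Fintype G] in
lemma gact_apply (g : G) (f : κ → Poly N) : D.gact ρ g f = cmul (ρ g) (D.actv κ g f) := rfl

omit [Fintype G] in
lemma gact_smul (g : G) (p : Poly N) (f : κ → Poly N) :
    D.gact ρ g (p • f) = D.act g p • D.gact ρ g f := by
  rw [gact_apply, actv_smul, map_smul, gact_apply]

omit [Fintype G] in
lemma gact_mul (g h : G) (f : κ → Poly N) :
    D.gact ρ (g * h) f = D.gact ρ g (D.gact ρ h f) := by
  have : D.actv κ (g * h) f = D.actv κ g (D.actv κ h f) := by
    ext1 k
    simp only [actv_apply, act_mul_apply]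
  rw [gact_apply, gact_apply, gact_apply, map_mul, cmul_mul, actv_cmul, this]

omit [Fintype G] in
lemma gact_one (f : κ → Poly N) : D.gact ρ 1 f = f := by
  rw [gact_apply, map_one, cmul_one]
  ext1 k
  simp [actv_apply]

/-- The unnormalised projector to the `χ`-isotypic part of `ρ` under the stabilizer of `H`. -/
def E (H : A) : Matrix κ κ ℂ := ∑ s : D.stab H, (D.χ s)⁻¹ • ρ s

lemma E_mul {H : A} {s : G} (hs : s ∈ D.stab H) : D.E ρ H * ρ s = D.χ s • D.E ρ H := by
  rw [E, Finset.sum_mul, Finset.smul_sum]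
  refine Fintype.sum_equiv (Equiv.mulRight ⟨s, hs⟩) _ _ fun t => ?_
  simp only [Equiv.coe_mulRight, Subgroup.coe_mul, χ_mul, map_mul, Matrix.smul_mul, smul_smul]
  congr 1
  have := D.χ_ne_zero s
  have := D.χ_ne_zero t
  field_simp

lemma card_stab (H : A) : Fintype.card (D.stab H) = D.n H := by
  rw [n, Nat.card_eq_fintype_card]

lemma E_mul_self (H : A) : D.E ρ H * D.E ρ H = (D.n H : ℂ) • D.E ρ H := by
  conv_lhs => rw [E.eq_def D ρ H, Finset.mul_sum, ← E.eq_def D ρ H]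
  have : ∀ s : D.stab H, D.E ρ H * ((D.χ s)⁻¹ • ρ s) = D.E ρ H := by
    intro s
    rw [Matrix.mul_smul, D.E_mul ρ s.2, smul_smul, inv_mul_cancel₀ (D.χ_ne_zero _), one_smul]
  simp only [this, Finset.sum_const, Finset.card_univ, card_stab]
  rw [Nat.cast_smul_eq_nsmul]

lemma E_conj {g : G} {H H' : A} (h : ∀ s, s ∈ D.stab H ↔ g * s * g⁻¹ ∈ D.stab H') :
    ρ g * D.E ρ H = D.E ρ H' * ρ g := by
  rw [E, E, Finset.mul_sum, Finset.sum_mul]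
  refine Fintype.sum_equiv (Equiv.subtypeEquiv (MulAut.conj g).toEquiv h) _ _ fun s => ?_
  change _ = ((D.χ (g * s * g⁻¹))⁻¹ • ρ (g * s * g⁻¹)) * ρ g
  rw [Matrix.mul_smul, Matrix.smul_mul, ← map_mul, ← map_mul, χ_mul, χ_mul, χ_inv]
  have := D.χ_ne_zero g
  congr 1
  · field_simp
  · congr 1; group

lemma E_mul_map (τ : G →* Matrix κ' κ' ℂ) {P : Matrix κ κ' ℂ} (hP : ∀ g, P * τ g = ρ g * P)
    (H : A) : P * D.E τ H = D.E ρ H * P := by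
  rw [E, E, Matrix.mul_sum, Matrix.sum_mul]
  exact Finset.sum_congr rfl fun s _ => by rw [Matrix.mul_smul, Matrix.smul_mul, hP]

/-- The space of vectors `f` of polynomials, homogeneous of degree `d`, whose `χ`-part at each
hyperplane `H` is divisible by `ℓ_H ^ (m_H n_H)`. -/
def M (d : ℕ) : Submodule ℂ (κ → Poly N) where
  carrier := {f | (∀ k, (f k).IsHomogeneous d) ∧ ∀ H k, D.ℓ H ^ D.a H ∣ cmul (D.E ρ H) f k}
  add_mem' := by
    rintro f f' ⟨h1, h2⟩ ⟨h1', h2'⟩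
    refine ⟨fun k => (h1 k).add (h1' k), fun H k => ?_⟩
    rw [map_add]
    exact dvd_add (h2 H k) (h2' H k)
  zero_mem' := ⟨fun k => isHomogeneous_zero _ _ _, fun H k => by rw [map_zero]; exact dvd_zero _⟩
  smul_mem' := by
    rintro c f ⟨h1, h2⟩
    rw [← C_smul_eq]
    refine ⟨fun k => ?_, fun H k => ?_⟩
    · simpa using (isHomogeneous_C _ c).mul (h1 k)
    · rw [map_smul]
      exact Dvd.dvd.mul_left (h2 H k) _

variable {ρ} {d : ℕ}

lemma gact_dvd {f : κ → Poly N} (hf : ∀ H k, D.ℓ H ^ D.a H ∣ cmul (D.E ρ H) f k) (g : G)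
    (H : A) (k : κ) : D.ℓ H ^ D.a H ∣ cmul (D.E ρ H) (D.gact ρ g f) k := by
  obtain ⟨H', c, hc, hl, ha, hst⟩ := D.exists_perm g⁻¹ H
  have hst' : ∀ s, s ∈ D.stab H' ↔ g * s * g⁻¹ ∈ D.stab H := by
    intro s
    rw [hst]
    congr! 1
    group
  obtain ⟨u, hu⟩ := exists_eq_smul_iff.2 (hf H')
  have hl' : D.act g (D.ℓ H') = C c⁻¹ * D.ℓ H := by
    have h1 := congrArg (D.act g) hl
    rw [← act_mul_apply, mul_inv_cancel, act_one_apply, map_mul, act_C] at h1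
    rw [h1, ← mul_assoc, ← C_mul, inv_mul_cancel₀ hc, C_1, one_mul]
  revert k
  rw [← exists_eq_smul_iff, gact_apply, ← cmul_mul, ← D.E_conj ρ hst', cmul_mul, ← actv_cmul, hu,
    actv_smul, map_pow, hl', mul_pow, ha, map_smul]
  exact ⟨C c⁻¹ ^ D.a H • cmul (ρ g) (D.actv κ g u), by rw [smul_smul, mul_comm]⟩

lemma gact_isHomogeneous {f : κ → Poly N} (hf : ∀ k, (f k).IsHomogeneous d) (g : G) (k : κ) :
    (D.gact ρ g f k).IsHomogeneous d := by
  rw [gact_apply]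
  refine cmul_isHomogeneous _ (fun k => ?_) k
  rw [actv_apply]
  exact D.act_isHomogeneous g (hf k)

lemma gact_mem {f : κ → Poly N} (hf : f ∈ D.M ρ d) (g : G) : D.gact ρ g f ∈ D.M ρ d :=
  ⟨D.gact_isHomogeneous hf.1 g, D.gact_dvd hf.2 g⟩

variable (ρ) in
/-- The unnormalised projector to the `χ`-part of the polynomial vectors under the stabilizer
of `H`. -/
def proj (H : A) : (κ → Poly N) →ₗ[ℂ] (κ → Poly N) := ∑ s : D.stab H, (D.χ s)⁻¹ • D.gact ρ s

lemma proj_apply (H : A) (f : κ → Poly N) :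
    D.proj ρ H f = ∑ s : D.stab H, (D.χ s)⁻¹ • D.gact ρ s f := by
  simp [proj]

lemma proj_mem (H : A) {f : κ → Poly N} (hf : f ∈ D.M ρ d) : D.proj ρ H f ∈ D.M ρ d := by
  rw [proj_apply]
  exact Submodule.sum_mem _ fun s _ => Submodule.smul_mem _ _ (D.gact_mem hf _)

lemma ℓ_dvd_proj {H : A} (hm : D.m H ≠ 0) {f : κ → Poly N} (hf : f ∈ D.M ρ d) (k : κ) :
    D.ℓ H ∣ D.proj ρ H f k := by
  have h1 : D.ℓ H ∣ cmul (D.E ρ H) f k :=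
    (dvd_pow_self _ (Nat.mul_ne_zero hm (D.n_pos H).ne')).trans (hf.2 H k)
  rw [← dvd_sub_left h1]
  have h2 : D.proj ρ H f - cmul (D.E ρ H) f =
      ∑ s : D.stab H, (C (D.χ s)⁻¹ : Poly N) • cmul (ρ s) (D.actv κ s f - f) := by
    rw [proj_apply, E, cmul_sum_left, ← Finset.sum_sub_distrib]
    refine Finset.sum_congr rfl fun s _ => ?_
    rw [cmul_smul_left, ← C_smul_eq, map_sub, smul_sub, gact_apply]
  rw [← Pi.sub_apply, h2, Finset.sum_apply]
  refine Finset.dvd_sum fun s _ => Dvd.dvd.mul_left ?_ _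
  rw [cmul_apply]
  exact Finset.dvd_sum fun j _ => Dvd.dvd.mul_left (D.ℓ_dvd_act_sub s.2 _) _

/-- The `χ`-part of the projection of `ℓ ^ a • u` to first order. -/
lemma E_proj {H : A} {f u : κ → Poly N} (hu : cmul (D.E ρ H) f = D.ℓ H ^ D.a H • u) :
    ∃ w : κ → Poly N, cmul (D.E ρ H) (D.proj ρ H f) =
      D.ℓ H ^ D.a H • ((C (D.n H : ℂ) : Poly N) • u + D.ℓ H • w) := by
  have h1 : ∀ s : D.stab H, ∃ w : κ → Poly N,
      cmul (D.E ρ H) ((C (D.χ s)⁻¹ : Poly N) • D.gact ρ s f) =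
        D.ℓ H ^ D.a H • (u + D.ℓ H • w) := by
    intro s
    obtain ⟨w, hw⟩ := exists_eq_smul_iff.2 fun k => D.ℓ_dvd_act_sub s.2 (u k)
    refine ⟨w, ?_⟩
    rw [map_smul, gact_apply, ← cmul_mul, D.E_mul ρ s.2, cmul_smul_left, smul_smul, ← C_mul,
      inv_mul_cancel₀ (D.χ_ne_zero _), C_1, one_smul, ← actv_cmul, hu, actv_smul,
      D.act_ℓ_pow_a s.2, ← hw]
    congr 1
    ext1 k
    simp [actv_apply]
  choose w hw using h1
  refine ⟨∑ s, w s, ?_⟩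
  rw [proj_apply, map_sum]
  simp only [← C_smul_eq, hw]
  rw [← Finset.smul_sum, Finset.sum_add_distrib, ← Finset.smul_sum, Finset.sum_const,
    Finset.card_univ, card_stab]
  congr 2
  rw [C_smul_eq, Nat.cast_smul_eq_nsmul]

/-- In the minimal degree in which `M` is nonzero, partial derivatives are given by
divided projections. -/
lemma pderiv_eq_of_minimal [Fintype A] (hd : ∀ d' < d, D.M ρ d' = ⊥) {f : κ → Poly N}
    (hf : f ∈ D.M ρ d) : ∃ h : A → κ → Poly N, (∀ H, D.m H ≠ 0 → D.ℓ H • h H = D.proj ρ H f) ∧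
      ∀ j k, pderiv j (f k) = ∑ H, C (D.m H * D.α H j) * h H k := by
  have h1 : ∀ H, ∃ h : κ → Poly N, D.m H ≠ 0 → D.ℓ H • h = D.proj ρ H f := by
    intro H
    by_cases hm : D.m H = 0
    · exact ⟨0, fun h => absurd hm h⟩
    · obtain ⟨u, hu⟩ := exists_eq_smul_iff.2 (D.ℓ_dvd_proj hm hf)
      exact ⟨u, fun _ => hu.symm⟩
  choose h hh using h1
  refine ⟨h, hh, ?_⟩
  have hlh : ∀ H, D.m H ≠ 0 → ∀ k, (D.ℓ H * h H k).IsHomogeneous d := fun H hm k => by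
    have h2 : D.ℓ H * h H k = D.proj ρ H f k := congrFun (hh H hm) k
    rw [h2]
    exact (D.proj_mem H hf).1 k
  have hhom : ∀ H, D.m H ≠ 0 → ∀ k, (h H k).IsHomogeneous (d - 1) := fun H hm k =>
    isHomogeneous_of_mul (D.ℓ_isHomogeneous H) (D.ℓ_ne_zero H) (hlh H hm k)
  intro j
  rcases Nat.eq_zero_or_pos d with rfl | hpos
  · intro k
    have h2 : f k = C (coeff 0 (f k)) := by
      by_cases h0 : f k = 0
      · simp [h0]
      · exact totalDegree_eq_zero_iff_eq_C.1 ((hf.1 k).totalDegree h0)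
    rw [h2, pderiv_C, eq_comm]
    refine Finset.sum_eq_zero fun H _ => ?_
    by_cases hm : D.m H = 0
    · simp [hm]
    · have : h H k = 0 := by
        by_contra h0
        have := le_of_isHomogeneous_mul (D.ℓ_isHomogeneous H) (D.ℓ_ne_zero H) h0 (hlh H hm k)
        omega
      rw [this, mul_zero]
  let T : κ → Poly N := fun k => pderiv j (f k) - ∑ H, C (D.m H * D.α H j) * h H k
  suffices hT : T ∈ D.M ρ (d - 1) by
    rw [hd (d - 1) (by omega), Submodule.mem_bot] at hT
    exact fun k => sub_eq_zero.1 (congrFun hT k)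
  refine ⟨fun k => ((hf.1 k).pderiv).sub (IsHomogeneous.sum _ _ _ fun H _ => ?_), fun H => ?_⟩
  · by_cases hm : D.m H = 0
    · simp only [hm, Nat.cast_zero, zero_mul, C_0]; exact isHomogeneous_zero _ _ _
    · simpa using (isHomogeneous_C _ (D.m H * D.α H j : ℂ)).mul (hhom H hm k)
  by_cases hm : D.m H = 0
  · intro k; simp [a, hm]
  have hT : T = (fun k => pderiv j (f k)) - ∑ H, (C (D.m H * D.α H j) : Poly N) • h H := by
    ext1 k; simp [T]
  obtain ⟨u, hu⟩ := exists_eq_smul_iff.2 (hf.2 H)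
  obtain ⟨w, hw⟩ := D.E_proj hu
  have hder : cmul (D.E ρ H) (fun k => pderiv j (f k)) =
      fun k => pderiv j (cmul (D.E ρ H) f k) := by
    ext1 k
    simp [cmul_apply]
  have ha : D.a H = D.a H - 1 + 1 := by
    have : 0 < D.a H := Nat.mul_pos (Nat.pos_of_ne_zero hm) (D.n_pos H)
    omega
  have hEh : cmul (D.E ρ H) (h H) =
      D.ℓ H ^ (D.a H - 1) • ((C (D.n H : ℂ) : Poly N) • u + D.ℓ H • w) := by
    have h3 : D.ℓ H • cmul (D.E ρ H) (h H) = D.ℓ H • (D.ℓ H ^ (D.a H - 1) •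
        ((C (D.n H : ℂ) : Poly N) • u + D.ℓ H • w)) := by
      rw [← map_smul, hh H hm, hw, smul_smul, ← pow_succ', ← ha]
    exact smul_right_injective _ (D.ℓ_ne_zero H) h3
  intro k
  rw [hT, map_sub, map_sum, ← Finset.add_sum_erase _ _ (Finset.mem_univ H), ← sub_sub,
    Pi.sub_apply]
  refine dvd_sub ?_ ?_
  · rw [hder, hu, map_smul, hEh]
    simp only [Pi.sub_apply, Pi.smul_apply, Pi.add_apply, smul_eq_mul, Derivation.leibniz,
      Derivation.leibniz_pow, pderiv_ℓ]
    refine ⟨pderiv j (u k) - C (D.m H * D.α H j) * w k, ?_⟩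
    rw [nsmul_eq_mul]
    conv_rhs => rw [ha, pow_succ]
    conv_lhs =>
      enter [1, 1, 1]
      rw [ha, pow_succ]
    have hcast : ((D.a H : ℕ) : Poly N) = C (D.m H : ℂ) * C (D.n H : ℂ) := by
      simp [a]
    rw [hcast, C_mul]
    ring
  · rw [Finset.sum_apply]
    refine Finset.dvd_sum fun H' hH' => ?_
    have hne : H ≠ H' := (Finset.ne_of_mem_erase hH').symm
    by_cases hm' : D.m H' = 0
    · simp [hm']
    rw [map_smul]
    refine Dvd.dvd.mul_left (D.dvd_of_dvd_mul_ℓ hne ?_) _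
    have := (D.proj_mem H' hf).2 H k
    rw [← hh H' hm', map_smul] at this
    exact this

end ReflData

end ReflVF

namespace ReflVF

/-- A matrix representation without proper nonzero invariant subspaces. -/
def IsIrr {G κ : Type} [Group G] [Fintype κ] [DecidableEq κ] (ρ : G →* Matrix κ κ ℂ) : Prop :=
  ∀ U : Submodule ℂ (κ → ℂ), (∀ g, ∀ v ∈ U, (ρ g).mulVec v ∈ U) → U = ⊥ ∨ U = ⊤

open scoped Classical

variable {N : ℕ} {G A : Type} [Group G] [Fintype G] [Fintype A]
variable {κ κ' : Type} [Fintype κ] [Fintype κ'] [DecidableEq κ] [DecidableEq κ']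

set_option linter.unusedSectionVars false

namespace ReflData

variable (D : ReflData N G A) {ρ : G →* Matrix κ κ ℂ} {τ : G →* Matrix κ' κ' ℂ} {d : ℕ}

lemma euler (hd : ∀ d' < d, D.M ρ d' = ⊥) {f : κ → Poly N} (hf : f ∈ D.M ρ d) :
    (d : ℂ) • f = ∑ H, (D.m H : ℂ) • D.proj ρ H f := by
  obtain ⟨h, hh, hder⟩ := D.pderiv_eq_of_minimal hd hf
  ext1 k
  have h1 := (hf.1 k).sum_X_mul_pderiv
  simp only [hder _ k, Finset.mul_sum] at h1
  rw [Finset.sum_comm] at h1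
  rw [Pi.smul_apply, Nat.cast_smul_eq_nsmul, ← h1, Finset.sum_apply]
  refine Finset.sum_congr rfl fun H _ => ?_
  by_cases hm : D.m H = 0
  · simp [hm]
  · rw [← hh H hm, Pi.smul_apply, Pi.smul_apply, smul_eq_C_mul, smul_eq_mul, ℓ, linPoly,
      Finset.sum_mul, Finset.mul_sum]
    refine Finset.sum_congr rfl fun j _ => ?_
    rw [C_mul]
    ring

lemma prod_mul_pderiv (hd : ∀ d' < d, D.M ρ d' = ⊥) {f : κ → Poly N} (hf : f ∈ D.M ρ d)
    (j : Fin N) (k : κ) : (∏ H, D.ℓ H) * pderiv j (f k) =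
      ∑ H, (C (D.m H * D.α H j) * ∏ H' ∈ Finset.univ.erase H, D.ℓ H') * D.proj ρ H f k := by
  obtain ⟨h, hh, hder⟩ := D.pderiv_eq_of_minimal hd hf
  rw [hder, Finset.mul_sum]
  refine Finset.sum_congr rfl fun H _ => ?_
  by_cases hm : D.m H = 0
  · simp [hm]
  · rw [← hh H hm, Pi.smul_apply, smul_eq_mul, ← Finset.mul_prod_erase _ _ (Finset.mem_univ H)]
    ring

variable (ρ) in
lemma exists_M_ne_bot [Nonempty κ] : ∃ d, D.M ρ d ≠ ⊥ := by
  let p : Poly N := ∏ H, D.ℓ H ^ D.a H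
  have hp : p.IsHomogeneous (∑ H, D.a H) :=
    IsHomogeneous.prod _ _ _ fun H _ => by simpa using (D.ℓ_isHomogeneous H).pow (D.a H)
  have hp0 : p ≠ 0 := Finset.prod_ne_zero_iff.2 fun H _ => pow_ne_zero _ (D.ℓ_ne_zero H)
  obtain ⟨k₀⟩ := ‹Nonempty κ›
  refine ⟨∑ H, D.a H, (Submodule.ne_bot_iff _).2 ⟨fun _ => p, ⟨fun _ => hp, fun H k => ?_⟩,
    fun h => hp0 (congrFun h k₀)⟩⟩
  rw [cmul_apply]
  exact Finset.dvd_sum fun j _ => Dvd.dvd.mul_left (Finset.dvd_prod_of_mem _ (Finset.mem_univ H)) _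

variable (ρ) in
lemma exists_minimal_degree [Nonempty κ] : ∃ d, D.M ρ d ≠ ⊥ ∧ ∀ d' < d, D.M ρ d' = ⊥ := by
  refine ⟨Nat.find (D.exists_M_ne_bot ρ), Nat.find_spec (D.exists_M_ne_bot ρ), fun d' h => ?_⟩
  by_contra h'
  exact Nat.find_min _ h h'

variable (τ) in
/-- The sum over the hyperplanes of the multiplicities weighted by the ranks of the projectors. -/
def wt : ℂ := ∑ H, (D.m H : ℂ) * (D.E τ H).trace

section Equivariant

variable {R : (κ' → ℂ) →ₗ[ℂ] (κ → Poly N)}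

lemma proj_equivariant (hR : ∀ g v, R ((τ g).mulVec v) = D.gact ρ g (R v)) (H : A) (v : κ' → ℂ) :
    D.proj ρ H (R v) = R ((D.E τ H).mulVec v) := by
  rw [proj_apply, E, Matrix.sum_mulVec, map_sum]
  refine Finset.sum_congr rfl fun s _ => ?_
  rw [Matrix.smul_mulVec, map_smul, hR]

lemma degree_mul_card (hτ : IsIrr τ) (hR : ∀ g v, R ((τ g).mulVec v) = D.gact ρ g (R v))
    (hR0 : R ≠ 0) (hd : ∀ d' < d, D.M ρ d' = ⊥) (hRM : ∀ v, R v ∈ D.M ρ d) :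
    (d : ℂ) * Fintype.card κ' = D.wt τ := by
  have hker : LinearMap.ker R = ⊥ := by
    refine (hτ (LinearMap.ker R) fun g v hv => ?_).resolve_right fun h =>
      hR0 (LinearMap.ker_eq_top.1 h)
    rw [LinearMap.mem_ker, hR, LinearMap.mem_ker.1 hv, map_zero]
  have h1 : (d : ℂ) • (1 : Matrix κ' κ' ℂ) = ∑ H, (D.m H : ℂ) • D.E τ H := by
    apply Matrix.toLin'.injective
    apply LinearMap.ext
    intro v
    apply LinearMap.ker_eq_bot.1 hker
    rw [Matrix.toLin'_apply, Matrix.toLin'_apply, Matrix.smul_mulVec, Matrix.one_mulVec, map_smul,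
      D.euler hd (hRM v), Matrix.sum_mulVec, map_sum]
    refine Finset.sum_congr rfl fun H _ => ?_
    rw [Matrix.smul_mulVec, map_smul, D.proj_equivariant hR]
  have h2 := congrArg Matrix.trace h1
  rw [Matrix.trace_smul, Matrix.trace_one, Matrix.trace_sum] at h2
  simpa [wt, Matrix.trace_smul] using h2

end Equivariant

/-- Equivariant maps from one irreducible representation into minimal degree parts for pairwise
separated irreducible representations have no common linear annihilator. -/
lemma no_annihilator {ι : Type} [Fintype ι] {r : ι → ℕ}
    (σ : ∀ i, G →* Matrix (Fin (r i)) (Fin (r i)) ℂ) (hσ : ∀ i, IsIrr (σ i))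
    (x : ι → G → ℂ) (hx : ∀ i j, ∑ g, x i g • σ j g = if i = j then 1 else 0)
    (d : ι → ℕ) (hd : ∀ i, ∀ d' < d i, D.M (σ i) d' = ⊥)
    (R : ∀ i, (κ' → ℂ) →ₗ[ℂ] (Fin (r i) → Poly N))
    (hR : ∀ i g v, R i ((τ g).mulVec v) = D.gact (σ i) g (R i v))
    (hR0 : ∀ i, R i ≠ 0) (hRM : ∀ i v, R i v ∈ D.M (σ i) (d i))
    (lam : (Σ i, Fin (r i)) → Poly N) (hlam : ∀ v, ∑ k, lam k * R k.1 v k.2 = 0) : lam = 0 := by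
  by_contra h0
  obtain ⟨mu, hmu0, hmu⟩ := exists_const_annihilator (fun v (k : Σ i, Fin (r i)) => R k.1 v k.2)
    (fun lam hlam v j => by
      have hpr : (∏ H, D.ℓ H) ≠ 0 := Finset.prod_ne_zero_iff.2 fun H _ => D.ℓ_ne_zero H
      refine (mul_eq_zero.1 ?_).resolve_left hpr
      rw [Finset.mul_sum]
      simp only [mul_left_comm _ (lam _), D.prod_mul_pderiv (hd _) (hRM _ v),
        D.proj_equivariant (hR _), Finset.mul_sum]
      rw [Finset.sum_comm]
      refine Finset.sum_eq_zero fun H _ => ?_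
      simp only [mul_left_comm (lam _)]
      rw [← Finset.mul_sum, hlam, mul_zero]) lam h0 hlam
  have hact : ∀ g v, ∑ i, ∑ k, C (Matrix.vecMul (fun k => mu ⟨i, k⟩) (σ i g) k) * R i v k = 0 := by
    intro g v
    apply D.act_injective g
    rw [map_zero, ← hmu ((τ g).mulVec v), Fintype.sum_sigma, map_sum]
    refine Finset.sum_congr rfl fun i _ => ?_
    simp only [hR, gact_apply, cmul_apply, map_sum, map_mul, act_C, actv_apply, Matrix.vecMul,
      dotProduct, Finset.sum_mul, Finset.mul_sum]
    rw [Finset.sum_comm]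
    simp only [mul_assoc]
  obtain ⟨⟨i, k₀⟩, hk₀⟩ := Function.ne_iff.1 hmu0
  have hiso : ∀ h v, ∑ k, C (Matrix.vecMul (fun k => mu ⟨i, k⟩) (σ i h) k) * R i v k = 0 := by
    have hone : ∀ j k, ∑ g, x i g * Matrix.vecMul (fun k => mu ⟨j, k⟩) (σ j g) k =
        if i = j then mu ⟨j, k⟩ else 0 := by
      intro j k
      have h1 := congrArg (fun B => Matrix.vecMul (fun k => mu ⟨j, k⟩) B k) (hx i j)
      simp only [Matrix.vecMul_sum, Finset.sum_apply, Matrix.vecMul_smul, Pi.smul_apply,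
        smul_eq_mul] at h1
      rw [h1]
      split_ifs <;> simp
    have h1 : ∀ v, ∑ k, C (mu ⟨i, k⟩) * R i v k = 0 := by
      intro v
      have h2 : ∑ g, C (x i g) *
          ∑ j, ∑ k, C (Matrix.vecMul (fun k => mu ⟨j, k⟩) (σ j g) k) * R j v k = 0 :=
        Finset.sum_eq_zero fun g _ => by rw [hact, mul_zero]
      simp only [Finset.mul_sum, ← mul_assoc, ← C_mul] at h2
      rw [Finset.sum_comm, Finset.sum_congr rfl fun j _ => Finset.sum_comm] at h2
      simp only [← Finset.sum_mul, ← map_sum, hone] at h2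
      rw [Finset.sum_eq_single i] at h2
      · simpa using h2
      · intro j _ hj
        simp [Ne.symm hj]
      · simp
    intro g v
    apply D.act_injective g
    rw [map_zero, ← h1 ((τ g).mulVec v)]
    simp only [hR, gact_apply, cmul_apply, map_sum, map_mul, act_C, actv_apply, Matrix.vecMul,
      dotProduct, Finset.sum_mul, Finset.mul_sum]
    rw [Finset.sum_comm]
    simp only [mul_assoc]
  let U : Submodule ℂ (Fin (r i) → ℂ) :=
    { carrier := {w | ∀ h, dotProduct (Matrix.vecMul (fun k => mu ⟨i, k⟩) (σ i h)) w = 0}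
      add_mem' := fun {a b} ha hb h => by rw [dotProduct_add, ha h, hb h, add_zero]
      zero_mem' := fun h => dotProduct_zero _
      smul_mem' := fun c a ha h => by rw [dotProduct_smul, ha h, smul_zero] }
  have hU : U = ⊥ := by
    refine (hσ i U fun g w hw h => ?_).resolve_right fun htop => hk₀ ?_
    · rw [Matrix.dotProduct_mulVec, Matrix.vecMul_vecMul, ← map_mul]
      exact hw (h * g)
    · have : (Pi.single k₀ 1 : Fin (r i) → ℂ) ∈ U := htop ▸ Submodule.mem_top
      simpa using this 1
  refine hR0 i (LinearMap.ext fun v => ?_)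
  ext1 k
  ext e
  have : (fun k => coeff e (R i v k)) ∈ U := by
    intro h
    have := congrArg (coeff e) (hiso h v)
    simpa [dotProduct, coeff_sum, coeff_C_mul] using this
  rw [hU, Submodule.mem_bot] at this
  exact congrFun this k

end ReflData

end ReflVF

namespace ReflVF

/-- A semisimple ring has finitely many simple left ideals representing all simple modules,
together with elements acting as `1` on one of them and as `0` on the others. -/
lemma exists_simple_ideals (B : Type) [Ring B] [IsSemisimpleRing B] :
    ∃ (ι : Type) (_ : Fintype ι) (_ : DecidableEq ι) (S : ι → Submodule B B) (x : ι → B),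
      (∀ i, IsSimpleModule B (S i)) ∧
      (∀ i j, ∀ y ∈ S j, x i * y = if i = j then y else 0) ∧
      ∀ (M : Type) [AddCommGroup M] [Module B M] [Nontrivial M],
        ∃ i, ∃ f : S i →ₗ[B] M, Function.Injective f := by
  classical
  let ι := isotypicComponents B B
  have : Fintype ι := Fintype.ofFinite ι
  have hS : ∀ i : ι, ∃ S : Submodule B B, IsSimpleModule B S ∧ i.1 = isotypicComponent B B S :=
    fun i => i.2
  choose S hsimple hSi using hS
  have hle : ∀ i, S i ≤ i.1 := fun i => by
    conv_rhs => rw [hSi i]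
    exact Submodule.le_isotypicComponent (S i)
  have htop : (1 : B) ∈ ⨆ i : ι, i.1 := by
    rw [← sSup_eq_iSup', sSup_isotypicComponents]
    trivial
  have h1 : ∃ μ : ∀ i : ι, i.1, ∑ i, (μ i : B) = 1 := by
    refine (Submodule.mem_iSup_finset_iff_exists_sum (s := Finset.univ)
      (fun i : ι => i.1) 1).1 ?_
    simpa using htop
  obtain ⟨μ, hμ⟩ := h1
  have hind := (sSupIndep_iff (isotypicComponents B B)).1 (sSupIndep_isotypicComponents B B)
  have hright : ∀ (i : ι) (b c : B), b ∈ i.1 → b * c ∈ i.1 := by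
    intro i b c hb
    have h2 := LinearMap.le_comap_isotypicComponent (S i) (LinearMap.toSpanSingleton B B c)
    rw [← hSi i] at h2
    exact h2 hb
  have hoff : ∀ i j, i ≠ j → ∀ y ∈ S j, (μ i : B) * y = 0 := by
    intro i j hij y hy
    have hd := hind.pairwiseDisjoint hij
    exact Submodule.disjoint_def.1 hd _ (hright i _ _ (μ i).2)
      (j.1.smul_mem (μ i : B) (hle j hy))
  refine ⟨ι, inferInstance, inferInstance, S, fun i => μ i, hsimple, ?_, ?_⟩
  · intro i j y hy
    split_ifs with h
    · subst h
      have h3 := congrArg (· * y) hμ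
      simp only [Finset.sum_mul, one_mul] at h3
      rwa [Finset.sum_eq_single i (fun k _ hk => hoff k i hk y hy) (by simp)] at h3
    · exact hoff i j h y hy
  · intro M _ _ _
    obtain ⟨m, hm⟩ := IsSemisimpleModule.exists_simple_submodule B M
    obtain ⟨I, ⟨e⟩⟩ := IsSemisimpleRing.exists_linearEquiv_ideal_of_isSimpleModule B m
    have hI : IsSimpleModule B I := IsSimpleModule.congr e.symm
    let c : ι := ⟨isotypicComponent B B I, I, hI, rfl⟩
    have hIc : I ≤ isotypicComponent B B (S c) := by
      rw [← hSi c]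
      exact Submodule.le_isotypicComponent I
    obtain ⟨e'⟩ := isIsotypicOfType_submodule_iff.1 (.isotypicComponent B B (S c)) I hIc
    exact ⟨c, m.subtype ∘ₗ (e'.symm.trans e.symm).toLinearMap,
      m.subtype_injective.comp (e'.symm.trans e.symm).injective⟩


/-- A finite group has finitely many irreducible complex matrix representations such that every
nonzero representation contains one of them, and which are separated by elements of the group
algebra. -/
lemma exists_irreps (G : Type) [Group G] [Fintype G] :
    ∃ (ι : Type) (_ : Fintype ι) (_ : DecidableEq ι) (r : ι → ℕ)
      (σ : ∀ i, G →* Matrix (Fin (r i)) (Fin (r i)) ℂ) (x : ι → G → ℂ),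
      (∀ i, 0 < r i) ∧ (∀ i, IsIrr (σ i)) ∧
      (∀ i j, ∑ g, x i g • σ j g = if i = j then 1 else 0) ∧
      ∀ (K : Type) [AddCommGroup K] [Module ℂ K] [Nontrivial K] (φ : Representation ℂ G K),
        ∃ i, ∃ R : (Fin (r i) → ℂ) →ₗ[ℂ] K, R ≠ 0 ∧
          ∀ g v, R ((σ i g).mulVec v) = φ g (R v) := by
  have : NeZero (Nat.card G : ℂ) := ⟨by simp⟩
  obtain ⟨ι, h1, h2, S, x, hS, hx, hc⟩ := exists_simple_ideals (MonoidAlgebra ℂ G)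
  have hBfin : Module.Finite ℂ (MonoidAlgebra ℂ G) :=
    Module.Finite.equiv (MonoidAlgebra.coeffLinearEquiv ℂ (S := ℂ) (M := G)).symm
  have hfin : ∀ i, Module.Finite ℂ (S i) := fun i =>
    inferInstanceAs (Module.Finite ℂ ((S i).restrictScalars ℂ))
  let b := fun i => Module.finBasis ℂ (S i)
  let Φ : ∀ i, MonoidAlgebra ℂ G →ₐ[ℂ] Matrix (Fin (Module.finrank ℂ (S i)))
      (Fin (Module.finrank ℂ (S i))) ℂ := fun i =>
    (LinearMap.toMatrixAlgEquiv (b i)).toAlgHom.comp (Algebra.lsmul ℂ ℂ (S i))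
  let σ : ∀ i, G →* Matrix (Fin (Module.finrank ℂ (S i))) (Fin (Module.finrank ℂ (S i))) ℂ :=
    fun i => (Φ i).toMonoidHom.comp (MonoidAlgebra.of ℂ G)
  have hΦ : ∀ i (y : MonoidAlgebra ℂ G), Φ i y = ∑ g, y.coeff g • σ i g := by
    intro i y
    conv_lhs => rw [← MonoidAlgebra.sum_coeff_single y]
    rw [Finsupp.sum_fintype _ _ (by simp), map_sum]
    refine Finset.sum_congr rfl fun g _ => ?_
    change _ = y.coeff g • Φ i (MonoidAlgebra.single g 1)
    rw [← map_smul]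
    congr 1
    simp
  have hmul : ∀ i (y : MonoidAlgebra ℂ G) (s : S i),
      (Φ i y).mulVec ((b i).equivFun s) = (b i).equivFun (y • s) := by
    intro i y s
    exact LinearMap.toMatrix_mulVec_repr (b i) (b i) (Algebra.lsmul ℂ ℂ (S i) y) s
  refine ⟨ι, h1, h2, fun i => Module.finrank ℂ (S i), σ, fun i g => (x i).coeff g,
    ?_, ?_, ?_, ?_⟩
  · intro i
    have := IsSimpleModule.nontrivial (MonoidAlgebra ℂ G) (S i)
    exact Module.finrank_pos
  · intro i U hU
    have hU' : ∀ (y : MonoidAlgebra ℂ G), ∀ v ∈ U, (Φ i y).mulVec v ∈ U := by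
      intro y v hv
      rw [hΦ, Matrix.sum_mulVec]
      refine U.sum_mem fun g _ => ?_
      rw [Matrix.smul_mulVec]
      exact U.smul_mem _ (hU g v hv)
    let T : Submodule (MonoidAlgebra ℂ G) (S i) :=
      { carrier := {s | (b i).equivFun s ∈ U}
        add_mem' := fun {s t} hs ht => by
          change (b i).equivFun (s + t) ∈ U
          rw [map_add]
          exact U.add_mem hs ht
        zero_mem' := by
          change (b i).equivFun 0 ∈ U
          rw [map_zero]
          exact U.zero_mem
        smul_mem' := fun y s hs => by
          change (b i).equivFun (y • s) ∈ U
          rw [← hmul]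
          exact hU' y _ hs }
    have hT : ∀ v, v ∈ U ↔ (b i).equivFun.symm v ∈ T := by
      intro v
      change _ ↔ (b i).equivFun _ ∈ U
      rw [LinearEquiv.apply_symm_apply]
    have := hS i
    rcases eq_bot_or_eq_top T with h | h
    · left
      rw [eq_bot_iff]
      intro v hv
      rw [hT, h, Submodule.mem_bot, LinearEquiv.map_eq_zero_iff] at hv
      exact hv
    · right
      rw [eq_top_iff]
      intro v _
      rw [hT, h]
      trivial
  · intro i j
    change ∑ g, (x i).coeff g • σ j g = _
    rw [← hΦ]
    have : Algebra.lsmul ℂ ℂ (S j) (x i) = if i = j then 1 else 0 := by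
      refine LinearMap.ext fun s => Subtype.ext ?_
      have := hx i j s s.2
      change x i * (s : MonoidAlgebra ℂ G) = _
      rw [this]
      split_ifs <;> rfl
    change LinearMap.toMatrixAlgEquiv (b j) (Algebra.lsmul ℂ ℂ (S j) (x i)) = _
    rw [this]
    split_ifs
    · rw [map_one]
    · rw [map_zero]
  · intro K _ _ _ φ
    have : Nontrivial φ.asModule := inferInstanceAs (Nontrivial K)
    obtain ⟨i, f, hf⟩ := hc φ.asModule
    let f' : S i →ₗ[ℂ] φ.asModule := f.restrictScalars ℂ
    let R : (Fin (Module.finrank ℂ (S i)) → ℂ) →ₗ[ℂ] K :=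
      φ.asModuleEquiv.toLinearMap ∘ₗ f' ∘ₗ (b i).equivFun.symm.toLinearMap
    refine ⟨i, R, ?_, ?_⟩
    · intro hR
      have := IsSimpleModule.nontrivial (MonoidAlgebra ℂ G) (S i)
      obtain ⟨s, hs⟩ := exists_ne (0 : S i)
      apply hs
      apply hf
      rw [map_zero]
      have h3 := LinearMap.congr_fun hR ((b i).equivFun s)
      simpa [R, f'] using h3
    · intro g v
      obtain ⟨s, rfl⟩ := (b i).equivFun.surjective v
      have h4 : (σ i g).mulVec ((b i).equivFun s) =
          (b i).equivFun (MonoidAlgebra.of ℂ G g • s) := hmul i _ s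
      rw [h4]
      have h5 : ∀ s, R ((b i).equivFun s) = φ.asModuleEquiv (f s) := by
        intro s
        simp [R, f']
      rw [h5, h5, map_smul, Representation.asModuleEquiv_map_smul]
      simp

end ReflVF

namespace ReflVF

open scoped Classical

set_option linter.unusedSectionVars false

/-- A rank factorization of an idempotent matrix. -/
lemma exists_factorization_of_idempotent {κ : Type} [Fintype κ] [DecidableEq κ]
    {e : Matrix κ κ ℂ} (he : e * e = e) :
    ∃ (k : ℕ) (P : Matrix κ (Fin k) ℂ) (Q : Matrix (Fin k) κ ℂ), P * Q = e ∧ Q * P = 1 := by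
  let f := Matrix.toLin' e
  have hf : ∀ v, f (f v) = f v := fun v => by
    simp only [f, Matrix.toLin'_apply, Matrix.mulVec_mulVec, he]
  let b := Module.finBasis ℂ (LinearMap.range f)
  let p : (Fin _ → ℂ) →ₗ[ℂ] (κ → ℂ) := (LinearMap.range f).subtype ∘ₗ b.equivFun.symm.toLinearMap
  let q : (κ → ℂ) →ₗ[ℂ] (Fin _ → ℂ) := b.equivFun.toLinearMap ∘ₗ f.rangeRestrict
  have hpq : p ∘ₗ q = f := by
    apply LinearMap.ext
    intro v
    simp [p, q]
  have hqp : q ∘ₗ p = LinearMap.id := by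
    apply LinearMap.ext
    intro v
    have : f.rangeRestrict ((b.equivFun.symm v : LinearMap.range f) : κ → ℂ) =
        b.equivFun.symm v := by
      apply Subtype.ext
      obtain ⟨u, hu⟩ := (b.equivFun.symm v).2
      change f _ = _
      rw [← hu, hf]
    change b.equivFun (f.rangeRestrict ((b.equivFun.symm v : LinearMap.range f) : κ → ℂ)) = v
    rw [this, LinearEquiv.apply_symm_apply]
  refine ⟨_, LinearMap.toMatrix' p, LinearMap.toMatrix' q, ?_, ?_⟩
  · rw [← LinearMap.toMatrix'_comp, hpq, LinearMap.toMatrix'_toLin']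
  · rw [← LinearMap.toMatrix'_comp, hqp, LinearMap.toMatrix'_id]

lemma det_one_add_smul_mul {R κ : Type} [CommRing R] [Fintype κ] [DecidableEq κ] {k : ℕ}
    (t : R) {P : Matrix κ (Fin k) R} {Q : Matrix (Fin k) κ R} (h : Q * P = 1) :
    (1 + (t - 1) • (P * Q)).det = t ^ k := by
  rw [← Matrix.smul_mul, Matrix.det_one_add_mul_comm, Matrix.mul_smul, h]
  have : (1 + (t - 1) • 1 : Matrix (Fin k) (Fin k) R) = t • 1 := by
    rw [sub_smul, one_smul, add_sub_cancel]
  rw [this, Matrix.det_smul]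
  simp

lemma det_isHomogeneous {N d : ℕ} {κ : Type} [Fintype κ] [DecidableEq κ] {X : Matrix κ κ (Poly N)}
    (hX : ∀ i j, (X i j).IsHomogeneous d) : X.det.IsHomogeneous (Fintype.card κ * d) := by
  rw [Matrix.det_apply]
  refine IsHomogeneous.sum _ _ _ fun s _ => ?_
  have h1 : (∏ i, X (s i) i).IsHomogeneous (Fintype.card κ * d) := by
    have := IsHomogeneous.prod Finset.univ (fun i => X (s i) i) (fun _ => d) fun i _ => hX _ _
    simpa using this
  rcases Int.units_eq_one_or (Equiv.Perm.sign s) with h | h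
  · rw [h, one_smul]; exact h1
  · rw [h, Units.neg_smul, one_smul]; exact h1.neg

variable {N : ℕ} {G A : Type} [Group G] [Fintype G] [Fintype A]
variable {κ κ' : Type} [Fintype κ] [Fintype κ'] [DecidableEq κ] [DecidableEq κ']

namespace ReflData

variable (D : ReflData N G A)

/-- The multiplicity of the `χ`-part of `ρ` at a hyperplane controls both the trace of the
projector and the divisibility of determinants. -/
lemma exists_mult (ρ : G →* Matrix κ κ ℂ) : ∃ k : A → ℕ,
    (∀ H, (D.E ρ H).trace = D.n H * k H) ∧
    ∀ X : Matrix κ κ (Poly N), (∀ j H i, D.ℓ H ^ D.a H ∣ cmul (D.E ρ H) (X j) i) →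
      ∏ H, D.ℓ H ^ (D.a H * k H) ∣ X.det := by
  have hn : ∀ H, (D.n H : ℂ) ≠ 0 := fun H => Nat.cast_ne_zero.2 (D.n_pos H).ne'
  have he : ∀ H, ((D.n H : ℂ)⁻¹ • D.E ρ H) * ((D.n H : ℂ)⁻¹ • D.E ρ H) =
      (D.n H : ℂ)⁻¹ • D.E ρ H := by
    intro H
    rw [Matrix.smul_mul, Matrix.mul_smul, E_mul_self, smul_smul (D.n H : ℂ)⁻¹ (D.n H : ℂ),
      inv_mul_cancel₀ (hn H), one_smul]
  choose k P Q hPQ hQP using fun H => exists_factorization_of_idempotent (he H)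
  refine ⟨k, fun H => ?_, fun X hX => D.prod_dvd _ fun H => ?_⟩
  · have h1 := congrArg Matrix.trace (hPQ H)
    rw [Matrix.trace_mul_comm, hQP, Matrix.trace_one, Matrix.trace_smul, Fintype.card_fin,
      smul_eq_mul] at h1
    rw [h1, mul_inv_cancel_left₀ (hn H)]
  · have h1 : ∀ j, ∃ u, cmul ((D.n H : ℂ)⁻¹ • D.E ρ H) (X j) = D.ℓ H ^ D.a H • u := by
      intro j
      rw [exists_eq_smul_iff]
      intro i
      rw [cmul_smul_left]
      exact Dvd.dvd.mul_left (hX j H i) _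
    choose u hu using h1
    set e := (D.n H : ℂ)⁻¹ • D.E ρ H
    have heu : ∀ j, cmul e (u j) = u j := by
      intro j
      have hinj : Function.Injective (fun f : κ → Poly N => D.ℓ H ^ D.a H • f) :=
        smul_right_injective _ (pow_ne_zero _ (D.ℓ_ne_zero H))
      apply hinj
      dsimp only
      rw [← map_smul, ← hu, ← cmul_mul, he]
    let Y : Matrix κ κ (Poly N) := Matrix.of fun i j => X j i - cmul e (X j) i + u j i
    let P' : Matrix κ (Fin (k H)) (Poly N) := (P H).map C
    let Q' : Matrix (Fin (k H)) κ (Poly N) := (Q H).map C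
    have hPQ' : P' * Q' = e.map C := by
      rw [show e = P H * Q H from (hPQ H).symm]
      exact Matrix.map_mul.symm
    have hQP' : Q' * P' = 1 := by
      rw [← Matrix.map_one (C : ℂ → Poly N) C_0 C_1, ← hQP H]
      exact Matrix.map_mul.symm
    have hXY : X.transpose = (1 + (D.ℓ H ^ D.a H - 1) • (P' * Q')) * Y := by
      rw [hPQ']
      ext1 i j
      have h2 : ∀ f : κ → Poly N, ((e.map C : Matrix κ κ (Poly N)).mulVec f) = cmul e f :=
        fun f => rfl
      have h3 : ((e.map C : Matrix κ κ (Poly N)) * Y) i j = u j i := by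
        change ((e.map C : Matrix κ κ (Poly N)).mulVec (X j - cmul e (X j) + u j)) i = _
        rw [h2, map_add, map_sub, ← cmul_mul, he, sub_self, zero_add, heu]
      rw [add_mul, one_mul, Matrix.smul_mul, Matrix.add_apply, Matrix.smul_apply, h3]
      have h4 := congrFun (hu j) i
      change X j i = X j i - cmul e (X j) i + u j i + _
      rw [h4]
      simp only [Pi.smul_apply, smul_eq_mul]
      ring
    rw [← Matrix.det_transpose, hXY, Matrix.det_mul, det_one_add_smul_mul _ hQP', ← pow_mul]
    exact dvd_mul_right _ _

lemma prod_pow_isHomogeneous (k : A → ℕ) : (∏ H, D.ℓ H ^ k H).IsHomogeneous (∑ H, k H) :=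
  IsHomogeneous.prod _ _ _ fun H _ => by simpa using (D.ℓ_isHomogeneous H).pow (k H)

lemma prod_pow_ne_zero (k : A → ℕ) : ∏ H, D.ℓ H ^ k H ≠ 0 :=
  Finset.prod_ne_zero_iff.2 fun H _ => pow_ne_zero _ (D.ℓ_ne_zero H)

/-- The natural number whose cast is `wt`, bounding the degree of a nonsingular matrix with rows
in `M`. -/
lemma exists_wt (ρ : G →* Matrix κ κ ℂ) : ∃ w : ℕ, (w : ℂ) = D.wt ρ ∧
    ∀ (d : ℕ) (X : Matrix κ κ (Poly N)), (∀ j, X j ∈ D.M ρ d) → X.det ≠ 0 →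
      w ≤ Fintype.card κ * d := by
  obtain ⟨k, hk, hdet⟩ := D.exists_mult ρ
  refine ⟨∑ H, D.a H * k H, ?_, fun d X hX h0 => ?_⟩
  · simp only [wt, hk, a, Nat.cast_sum, Nat.cast_mul, mul_assoc]
  · obtain ⟨q, hq⟩ := hdet X fun j H => (hX j).2 H
    refine le_of_isHomogeneous_mul (D.prod_pow_isHomogeneous _) (D.prod_pow_ne_zero _) ?_
      (hq ▸ det_isHomogeneous fun i j => (hX i).1 j)
    rintro rfl
    rw [mul_zero] at hq
    exact h0 hq

/-- A nonsingular matrix whose rows lie in `M` in the least degree allowed by the weight. -/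
def IsGood (ρ : G →* Matrix κ κ ℂ) : Prop :=
  ∃ (d : ℕ) (X : Matrix κ κ (Poly N)), (∀ j, X j ∈ D.M ρ d) ∧ X.det ≠ 0 ∧
    ((Fintype.card κ * d : ℕ) : ℂ) = D.wt ρ

/-- Every representation in a complete list of irreducible representations is good. -/
lemma isGood_of_complete {ι : Type} [Fintype ι] {r : ι → ℕ}
    (σ : ∀ i, G →* Matrix (Fin (r i)) (Fin (r i)) ℂ) (x : ι → G → ℂ)
    (hr : ∀ i, 0 < r i) (hσ : ∀ i, IsIrr (σ i))
    (hx : ∀ i j, ∑ g, x i g • σ j g = if i = j then 1 else 0)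
    (hc : ∀ (K : Type) [AddCommGroup K] [Module ℂ K] [Nontrivial K] (φ : Representation ℂ G K),
      ∃ i, ∃ R : (Fin (r i) → ℂ) →ₗ[ℂ] K, R ≠ 0 ∧
        ∀ g v, R ((σ i g).mulVec v) = φ g (R v)) (i : ι) : D.IsGood (σ i) := by
  have hne : ∀ i, Nonempty (Fin (r i)) := fun i => ⟨⟨0, hr i⟩⟩
  choose d hd0 hd using fun i => D.exists_minimal_degree (σ i)
  have hmap : ∀ i, ∃ j, ∃ R : (Fin (r j) → ℂ) →ₗ[ℂ] (Fin (r i) → Poly N),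
      (∀ g v, R ((σ j g).mulVec v) = D.gact (σ i) g (R v)) ∧ R ≠ 0 ∧
      ∀ v, R v ∈ D.M (σ i) (d i) := by
    intro i
    have : Nontrivial (D.M (σ i) (d i)) := Submodule.nontrivial_iff_ne_bot.2 (hd0 i)
    let φ : Representation ℂ G (D.M (σ i) (d i)) :=
      { toFun := fun g => (D.gact (σ i) g).restrict fun f hf => D.gact_mem hf g
        map_one' := by
          refine LinearMap.ext fun f => Subtype.ext ?_
          exact D.gact_one (σ i) f
        map_mul' := fun g h => by
          refine LinearMap.ext fun f => Subtype.ext ?_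
          exact D.gact_mul (σ i) g h f }
    obtain ⟨j, R, hR0, hR⟩ := hc _ φ
    refine ⟨j, (D.M (σ i) (d i)).subtype ∘ₗ R, fun g v => ?_, fun h => hR0 ?_, fun v => (R v).2⟩
    · exact congrArg Subtype.val (hR g v)
    · exact LinearMap.ext fun v => Subtype.ext (LinearMap.congr_fun h v)
  choose f R hR hR0 hRM using hmap
  have hfiber : ∀ j, ∑ i with f i = j, r i ≤ r j := by
    intro j
    have hmap' : ∀ i : {i // f i = j}, ∃ R : (Fin (r j) → ℂ) →ₗ[ℂ] (Fin (r i) → Poly N),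
        (∀ g v, R ((σ j g).mulVec v) = D.gact (σ i) g (R v)) ∧ R ≠ 0 ∧
        ∀ v, R v ∈ D.M (σ i) (d i) := by
      rintro ⟨i, rfl⟩
      exact ⟨R i, hR i, hR0 i, hRM i⟩
    choose T hT hT0 hTM using hmap'
    have hann := D.no_annihilator (fun i : {i // f i = j} => σ i) (fun i => hσ i)
      (fun i => x i) (fun i j => by rw [hx]; simp only [Subtype.ext_iff]) (fun i => d i)
      (fun i => hd i) T hT hT0 hTM
    let Λ : ((Σ i : {i // f i = j}, Fin (r i)) → Poly N) →ₗ[Poly N] (Fin (r j) → Poly N) :=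
      Matrix.mulVecLin (Matrix.of fun l k => T k.1 (Pi.single l 1) k.2)
    have hΛ : Function.Injective Λ := by
      rw [← LinearMap.ker_eq_bot, LinearMap.ker_eq_bot']
      intro lam hlam
      refine hann lam fun v => ?_
      have hv : v = ∑ l, v l • Pi.single l (1 : ℂ) := by
        ext1 k; simp [Pi.single_apply]
      rw [hv]
      simp only [map_sum, Finset.sum_apply, map_smul, Pi.smul_apply, Finset.mul_sum]
      rw [Finset.sum_comm]
      refine Finset.sum_eq_zero fun l _ => ?_
      have h1 := congrFun hlam l
      simp only [mul_smul_comm, ← Finset.smul_sum]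
      have h2 : ∑ k, lam k * T k.1 (Pi.single l 1) k.2 = 0 := by
        rw [← Pi.zero_apply (M := fun _ => Poly N) l, ← h1]
        exact Finset.sum_congr rfl fun k _ => mul_comm _ _
      rw [h2, smul_zero]
    have := card_le_of_injective (Poly N) Λ hΛ
    rw [Fintype.card_sigma, Fintype.card_fin] at this
    simp only [Fintype.card_fin] at this
    rwa [Finset.sum_subtype (p := fun i => f i = j) _ (by simp)]
  have htot : ∑ j, ∑ i with f i = j, r i = ∑ j, r j :=
    Finset.sum_fiberwise _ _ _
  have hfib : ∀ j, ∑ i with f i = j, r i = r j := fun j =>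
    (Finset.sum_eq_sum_iff_of_le fun j _ => hfiber j).1 htot j (Finset.mem_univ _)
  have hsurj : Function.Surjective f := by
    intro j
    by_contra! h
    have h1 := hfib j
    rw [Finset.sum_eq_zero fun i hi => absurd (Finset.mem_filter.1 hi).2 (h i)] at h1
    exact (hr j).ne h1
  have hbij : Function.Bijective f := Finite.surjective_iff_bijective.1 hsurj
  have hrf : ∀ i, r i = r (f i) := by
    intro i
    rw [← hfib (f i)]
    have : ({i' | f i' = f i} : Finset ι) = {i} := by
      ext i'
      simp [hbij.1.eq_iff]
    rw [this, Finset.sum_singleton]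
  have hX : ∀ i, ∃ X : Matrix (Fin (r i)) (Fin (r i)) (Poly N),
      (∀ j, X j ∈ D.M (σ i) (d i)) ∧ X.det ≠ 0 := by
    intro i
    let X : Matrix (Fin (r i)) (Fin (r i)) (Poly N) :=
      Matrix.of fun l => R i (Pi.single (Fin.cast (hrf i) l) 1)
    refine ⟨X, fun j => hRM i _, fun hdet => ?_⟩
    obtain ⟨lam, hlam0, hlam⟩ := Matrix.exists_mulVec_eq_zero_iff.2 hdet
    have hann := D.no_annihilator (fun _ : Unit => σ i) (fun _ => hσ i)
      (fun _ => x i) (fun _ _ => by rw [hx]; simp) (fun _ => d i)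
      (fun _ => hd i) (fun _ => R i) (fun _ => hR i) (fun _ => hR0 i) (fun _ => hRM i)
      (fun k => lam k.2) (fun v => ?_)
    · exact hlam0 (funext fun k => congrFun hann ⟨(), k⟩)
    · have hv : v = ∑ l, v l • Pi.single l (1 : ℂ) := by
        ext1 k; simp [Pi.single_apply]
      rw [hv, Fintype.sum_sigma, Fintype.sum_unique]
      simp only [map_sum, Finset.sum_apply, map_smul, Pi.smul_apply, Finset.mul_sum]
      rw [Finset.sum_comm]
      refine Finset.sum_eq_zero fun l _ => ?_
      have h1 := congrFun hlam (Fin.cast (hrf i).symm l)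
      simp only [mul_smul_comm, ← Finset.smul_sum]
      have h2 : ∑ k, lam k * R i (Pi.single l 1) k = 0 := by
        rw [← Pi.zero_apply (M := fun _ => Poly N) (Fin.cast (hrf i).symm l), ← h1]
        exact Finset.sum_congr rfl fun k _ => mul_comm _ _
      rw [h2, smul_zero]
  choose X hXM hXdet using hX
  choose w hw hwle using fun i => D.exists_wt (σ i)
  have hdeg : ∀ i, r i * d i = w (f i) := by
    intro i
    have h1 := D.degree_mul_card (hσ (f i)) (hR i) (hR0 i) (hd i) (hRM i)
    rw [Fintype.card_fin, ← hw] at h1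
    rw [mul_comm, hrf]
    exact_mod_cast h1
  have hle : ∀ i, w i ≤ w (f i) := by
    intro i
    have := hwle i (d i) (X i) (hXM i) (hXdet i)
    rwa [Fintype.card_fin, hdeg] at this
  have hweq : ∀ i, w i = w (f i) := fun i =>
    (Finset.sum_eq_sum_iff_of_le fun i _ => hle i).1
      (Equiv.sum_comp (Equiv.ofBijective f hbij) w).symm i (Finset.mem_univ _)
  refine ⟨d i, X i, hXM i, hXdet i, ?_⟩
  rw [Fintype.card_fin, hdeg, ← hweq, hw]

end ReflData

end ReflVF

namespace ReflVF

open scoped Classical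

set_option linter.unusedSectionVars false

variable {N : ℕ} {G A : Type} [Group G] [Fintype G] [Fintype A]
variable {κ κ' : Type} [Fintype κ] [Fintype κ'] [DecidableEq κ] [DecidableEq κ']

namespace ReflData

variable (D : ReflData N G A)

lemma cmul_mem {ρ : G →* Matrix κ κ ℂ} {τ : G →* Matrix κ' κ' ℂ} {P : Matrix κ κ' ℂ}
    (hP : ∀ g, P * τ g = ρ g * P) {d : ℕ} {f : κ' → Poly N} (hf : f ∈ D.M τ d) :
    cmul P f ∈ D.M ρ d := by
  refine ⟨cmul_isHomogeneous P hf.1, fun H k => ?_⟩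
  rw [← cmul_mul, ← D.E_mul_map ρ τ hP, cmul_mul, cmul_apply]
  exact Finset.dvd_sum fun j _ => Dvd.dvd.mul_left (hf.2 H j) _

lemma isGood_of_equiv {ρ : G →* Matrix κ κ ℂ} {τ : G →* Matrix κ' κ' ℂ} {P : Matrix κ κ' ℂ}
    {Q : Matrix κ' κ ℂ} (hP : ∀ g, P * τ g = ρ g * P) (hPQ : P * Q = 1) (hQP : Q * P = 1)
    (h : D.IsGood τ) : D.IsGood ρ := by
  obtain ⟨d, X, hX, hdet, hd⟩ := h
  have hwt : D.wt ρ = D.wt τ := by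
    refine Finset.sum_congr rfl fun H _ => ?_
    rw [← Matrix.mul_one (D.E τ H), ← hQP, ← Matrix.mul_assoc, Matrix.trace_mul_comm,
      ← Matrix.mul_assoc, D.E_mul_map ρ τ hP, Matrix.mul_assoc, hPQ, Matrix.mul_one]
  let X' : Matrix κ κ (Poly N) := Matrix.of fun j => ∑ j', Q j' j • cmul P (X j')
  refine ⟨d, X', fun j => ?_, fun h0 => ?_, ?_⟩
  · exact Submodule.sum_mem _ fun j' _ => Submodule.smul_mem _ _ (D.cmul_mem hP (hX j'))
  · obtain ⟨lam, hlam0, hlam⟩ := Matrix.exists_mulVec_eq_zero_iff.2 h0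
    let mu : κ' → Poly N := cmul P.transpose lam
    have hX' : ∀ j, ∑ k, X' j k * lam k = ∑ j', C (Q j' j) * (X.mulVec mu) j' := by
      intro j
      simp only [X', mu, Matrix.of_apply, Finset.sum_apply, Pi.smul_apply, cmul_apply,
        Matrix.mulVec, dotProduct, Matrix.transpose_apply, Finset.sum_mul, Finset.mul_sum,
        smul_eq_C_mul]
      rw [Finset.sum_comm]
      refine Finset.sum_congr rfl fun j' _ => ?_
      rw [Finset.sum_comm]
      refine Finset.sum_congr rfl fun _ _ => Finset.sum_congr rfl fun _ _ => ?_
      ring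
    have h1 : cmul Q.transpose (X.mulVec mu) = 0 := by
      ext1 j
      exact (hX' j).symm.trans (congrFun hlam j)
    have h2 : X.mulVec mu = 0 := by
      rw [← cmul_one (X.mulVec mu), ← Matrix.transpose_one, ← hQP, Matrix.transpose_mul, cmul_mul,
        h1, map_zero]
    have h3 : mu = 0 := by
      by_contra h
      exact hdet (Matrix.exists_mulVec_eq_zero_iff.1 ⟨mu, h, h2⟩)
    apply hlam0
    rw [← cmul_one lam, ← Matrix.transpose_one, ← hPQ, Matrix.transpose_mul, cmul_mul]
    change cmul _ mu = 0
    rw [h3, map_zero]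
  · rw [hwt, ← hd, Matrix.square_of_invertible P Q hPQ hQP]

/-- Evaluation of a polynomial vector field on the linear form of `H`. -/
def pair (H : A) : (Fin N → Poly N) →ₗ[Poly N] Poly N :=
  ∑ i, (C (D.α H i) : Poly N) • LinearMap.proj i

lemma pair_apply (H : A) (f : Fin N → Poly N) : D.pair H f = ∑ i, C (D.α H i) * f i := by
  simp [pair]

lemma sum_χ_inv (H : A) : ∑ s : D.stab H, (D.χ s)⁻¹ = 0 := by
  obtain ⟨t, ht, hdet⟩ := D.refl H
  have h1 : ∑ s : D.stab H, (D.χ s)⁻¹ = (D.χ t)⁻¹ * ∑ s : D.stab H, (D.χ s)⁻¹ := by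
    rw [Finset.mul_sum]
    refine (Fintype.sum_equiv (Equiv.mulLeft ⟨t, ht⟩) _ _ fun s => ?_).symm
    simp [χ_mul, mul_comm]
  by_contra h0
  have h2 : (D.χ t)⁻¹ = 1 := by
    have h3 : (1 : ℂ) * ∑ s : D.stab H, (D.χ s)⁻¹ = (D.χ t)⁻¹ * ∑ s : D.stab H, (D.χ s)⁻¹ := by
      rw [one_mul]; exact h1
    exact (mul_right_cancel₀ h0 h3).symm
  exact hdet (inv_eq_one.1 h2)

lemma E_V (H : A) : ∃ b, D.E D.V H = Matrix.vecMulVec b (D.α H) ∧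
    dotProduct (D.α H) b = D.n H := by
  choose b hb using fun s : D.stab H => (D.mem_stab H s).1 s.2
  have h1 : D.E D.V H = Matrix.vecMulVec (∑ s : D.stab H, (D.χ s)⁻¹ • b s) (D.α H) := by
    rw [E]
    simp only [hb, smul_add, Finset.sum_add_distrib, ← Finset.sum_smul, sum_χ_inv, zero_smul,
      zero_add]
    ext i j
    simp [Matrix.sum_apply, Matrix.vecMulVec_apply, Finset.sum_mul, mul_assoc]
  refine ⟨_, h1, ?_⟩
  have h2 : Matrix.vecMul (D.α H) (D.E D.V H) = (D.n H : ℂ) • D.α H := by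
    rw [E, Matrix.vecMul_sum]
    have : ∀ s : D.stab H, Matrix.vecMul (D.α H) ((D.χ s)⁻¹ • D.V s) = D.α H := by
      intro s
      rw [Matrix.vecMul_smul, D.vecMul_V s.2, smul_smul, inv_mul_cancel₀ (D.χ_ne_zero _), one_smul]
    simp only [this, Finset.sum_const, Finset.card_univ, card_stab, Nat.cast_smul_eq_nsmul]
  rw [h1, Matrix.vecMul_vecMulVec] at h2
  exact smul_left_injective ℂ (D.α_ne H) h2

lemma cmul_vecMulVec (b : Fin N → ℂ) (H : A) (f : Fin N → Poly N) (k : Fin N) :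
    cmul (Matrix.vecMulVec b (D.α H)) f k = C (b k) * D.pair H f := by
  simp [cmul_apply, Matrix.vecMulVec_apply, pair_apply, Finset.mul_sum, mul_assoc]

lemma pair_cmul_V {H : A} {s : G} (hs : s ∈ D.stab H) (f : Fin N → Poly N) :
    D.pair H (cmul (D.V s) f) = C (D.χ s) * D.pair H f := by
  have h := D.vecMul_V hs
  simp only [pair_apply, cmul_apply, Finset.mul_sum]
  rw [Finset.sum_comm]
  refine Finset.sum_congr rfl fun j _ => ?_
  have h1 := congrArg (C : ℂ → Poly N) (congrFun h j)
  simp only [Matrix.vecMul, dotProduct, Pi.smul_apply, smul_eq_mul, map_sum, map_mul] at h1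
  simp only [← mul_assoc, ← h1, Finset.sum_mul]

lemma dvd_E_V_iff (H : A) (p : Poly N) (f : Fin N → Poly N) :
    (∀ k, p ∣ cmul (D.E D.V H) f k) ↔ p ∣ D.pair H f := by
  obtain ⟨b, hb, hαb⟩ := D.E_V H
  simp only [hb, cmul_vecMulVec]
  refine ⟨fun h => ?_, fun h k => Dvd.dvd.mul_left h _⟩
  have h1 : p ∣ ∑ k, C (D.α H k) * (C (b k) * D.pair H f) :=
    Finset.dvd_sum fun k _ => Dvd.dvd.mul_left (h k) _
  have h2 : ∑ k, C (D.α H k) * (C (b k) * D.pair H f) = C (D.n H : ℂ) * D.pair H f := by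
    rw [← hαb, dotProduct, map_sum, Finset.sum_mul]
    simp only [C_mul, mul_assoc]
  have h3 : IsUnit (C (D.n H : ℂ) : Poly N) :=
    (IsUnit.mk0 _ (Nat.cast_ne_zero.2 (D.n_pos H).ne')).map C
  rwa [h2, h3.dvd_mul_left] at h1

lemma exists_good_basis (hN : 0 < N) : ∃ F : Matrix (Fin N) (Fin N) (Poly N), F.det ≠ 0 ∧
    (∀ j H, D.ℓ H ^ D.a H ∣ D.pair H (F j)) ∧
    ∀ f, (∀ H, D.ℓ H ^ D.a H ∣ D.pair H f) → ∃ c : Fin N → Poly N, f = ∑ j, c j • F j := by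
  have hgood : D.IsGood D.V := by
    obtain ⟨ι, _, _, r, σ, x, hr, hσ, hx, hc⟩ := exists_irreps G
    have : Nonempty (Fin N) := ⟨⟨0, hN⟩⟩
    let φ : Representation ℂ G (Fin N → ℂ) :=
      { toFun := fun g => Matrix.toLin' (D.V g)
        map_one' := by rw [map_one, Matrix.toLin'_one]; rfl
        map_mul' := fun g h => by rw [map_mul, Matrix.toLin'_mul]; rfl }
    obtain ⟨i, R, hR0, hR⟩ := hc _ φ
    have hR' : ∀ g v, R ((σ i g).mulVec v) = (D.V g).mulVec (R v) := hR
    have hker : LinearMap.ker R = ⊥ := by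
      refine (hσ i _ fun g v hv => ?_).resolve_right fun h => hR0 (LinearMap.ker_eq_top.1 h)
      rw [LinearMap.mem_ker] at hv ⊢
      rw [hR', hv, Matrix.mulVec_zero]
    have hrange : LinearMap.range R = ⊤ := by
      refine (D.irr _ fun g v hv => ?_).resolve_left fun h => hR0 (LinearMap.range_eq_bot.1 h)
      obtain ⟨u, rfl⟩ := hv
      exact ⟨(σ i g).mulVec u, hR' g u⟩
    let e := LinearEquiv.ofBijective R
      ⟨LinearMap.ker_eq_bot.1 hker, LinearMap.range_eq_top.1 hrange⟩
    have heR : (e : (Fin (r i) → ℂ) →ₗ[ℂ] (Fin N → ℂ)) = R := rfl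
    refine D.isGood_of_equiv (P := LinearMap.toMatrix' R)
      (Q := LinearMap.toMatrix' (e.symm : (Fin N → ℂ) →ₗ[ℂ] (Fin (r i) → ℂ))) ?_ ?_ ?_
      (D.isGood_of_complete σ x hr hσ (fun i j => by convert hx i j) hc i)
    · intro g
      apply Matrix.toLin'.injective
      rw [Matrix.toLin'_mul, Matrix.toLin'_mul, Matrix.toLin'_toMatrix']
      exact LinearMap.ext fun v => hR' g v
    · rw [← LinearMap.toMatrix'_comp, ← heR, LinearEquiv.comp_coe, LinearEquiv.symm_trans_self,
        LinearEquiv.refl_toLinearMap, LinearMap.toMatrix'_id]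
    · rw [← LinearMap.toMatrix'_comp, ← heR, LinearEquiv.comp_coe, LinearEquiv.self_trans_symm,
        LinearEquiv.refl_toLinearMap, LinearMap.toMatrix'_id]
  obtain ⟨d, F, hF, hdet, hd⟩ := hgood
  obtain ⟨k, hk, hdvd⟩ := D.exists_mult D.V
  have htr : ∀ H, (D.E D.V H).trace = D.n H := by
    intro H
    obtain ⟨b, hb, hαb⟩ := D.E_V H
    rw [hb, ← hαb, Matrix.trace_vecMulVec, dotProduct_comm]
  have hk1 : ∀ H, k H = 1 := by
    intro H
    have h1 := (htr H).symm.trans (hk H)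
    have h2 : (D.n H : ℂ) ≠ 0 := Nat.cast_ne_zero.2 (D.n_pos H).ne'
    have h3 : (k H : ℂ) = 1 := mul_left_cancel₀ h2 (by rw [← h1, mul_one])
    exact_mod_cast h3
  have hdeg : N * d = ∑ H, D.a H := by
    have : D.wt D.V = ((∑ H, D.a H : ℕ) : ℂ) := by
      simp only [wt, htr, a, Nat.cast_sum, Nat.cast_mul]
    rw [this, Fintype.card_fin] at hd
    exact_mod_cast hd
  simp only [hk1, mul_one, D.dvd_E_V_iff] at hdvd
  have hFd : ∀ j H, D.ℓ H ^ D.a H ∣ D.pair H (F j) := fun j H =>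
    (D.dvd_E_V_iff H _ _).1 fun k => (hF j).2 H k
  have hdvd' : ∀ X : Matrix (Fin N) (Fin N) (Poly N), (∀ j H, D.ℓ H ^ D.a H ∣ D.pair H (X j)) →
      ∏ H, D.ℓ H ^ D.a H ∣ X.det := hdvd
  obtain ⟨q, hq⟩ := hdvd' F hFd
  have hq0 : q ≠ 0 := by
    rintro rfl
    exact hdet (by rw [hq, mul_zero])
  have hqu : IsUnit q := by
    have h1 : q.IsHomogeneous (N * d - ∑ H, D.a H) := by
      refine isHomogeneous_of_mul (D.prod_pow_isHomogeneous _) (D.prod_pow_ne_zero _) ?_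
      rw [← hq]
      simpa using det_isHomogeneous fun i j => (hF i).1 j
    rw [hdeg, Nat.sub_self] at h1
    have h2 := totalDegree_eq_zero_iff_eq_C.1 (h1.totalDegree hq0)
    rw [h2] at hq0 ⊢
    exact (IsUnit.mk0 _ fun h => hq0 (by rw [h, C_0])).map C
  refine ⟨F, hdet, hFd, fun f hf => ?_⟩
  have h1 : ∀ j, F.det ∣ F.transpose.cramer f j := by
    intro j
    rw [hq, hqu.mul_right_dvd, Matrix.cramer_transpose_apply]
    refine hdvd' _ fun i H => ?_
    by_cases hij : i = j
    · subst hij; rw [Matrix.updateRow_self]; exact hf H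
    · rw [Matrix.updateRow_ne hij]; exact hFd i H
  choose c hc using h1
  refine ⟨c, ?_⟩
  have h2 := Matrix.mulVec_cramer F.transpose f
  rw [Matrix.det_transpose] at h2
  apply smul_right_injective _ hdet
  dsimp only
  rw [← h2]
  ext1 k
  simp only [Matrix.mulVec, dotProduct, hc, Matrix.transpose_apply, Pi.smul_apply,
    Finset.sum_apply, smul_eq_mul, Finset.mul_sum]
  refine Finset.sum_congr rfl fun j _ => ?_
  ring

end ReflData

end ReflVF

namespace ReflVF

open scoped Classical

set_option linter.unusedSectionVars false

variable {N : ℕ} {G A : Type} [Group G] [Fintype G] [Fintype A]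

namespace ReflData

variable (D : ReflData N G A)

lemma induction_on_gen {P : G → Prop} (hs : ∀ H, ∀ s ∈ D.stab H, P s) (h1 : P 1)
    (hm : ∀ g h, P g → P h → P (g * h)) (hi : ∀ g, P g → P g⁻¹) (g : G) : P g := by
  have hg : g ∈ Subgroup.closure {s | ∃ H, s ∈ D.stab H} := D.gen ▸ Subgroup.mem_top g
  induction hg using Subgroup.closure_induction with
  | mem x hx => obtain ⟨H, hx⟩ := hx; exact hs H x hx
  | one => exact h1
  | mul x y _ _ hx hy => exact hm x y hx hy
  | inv x _ hx => exact hi x hx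

/-- Vector fields `f` with `ℓ_H ^ (a_H + e) ∣ f(α_H)` for all `H`. -/
def vf (e : ℕ) : Submodule (Poly N) (Fin N → Poly N) where
  carrier := {f | ∀ H, D.ℓ H ^ (D.a H + e) ∣ D.pair H f}
  add_mem' := fun {f f'} h h' H => by rw [map_add]; exact dvd_add (h H) (h' H)
  zero_mem' := fun H => by rw [map_zero]; exact dvd_zero _
  smul_mem' := fun p f h H => by rw [map_smul]; exact Dvd.dvd.mul_left (h H) _

variable {e : ℕ}

lemma pair_actv (g : G) (H : A) (f : Fin N → Poly N) :
    D.pair H (D.actv (Fin N) g f) = D.act g (D.pair H f) := by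
  simp [pair_apply, actv_apply]

lemma gact_mem_vf {f : Fin N → Poly N} (hf : f ∈ D.vf e) (g : G) : D.gact D.V g f ∈ D.vf e := by
  intro H
  obtain ⟨H', c, hc, hl, ha, -⟩ := D.exists_perm g⁻¹ H
  have hα : Matrix.vecMul (D.α H) (D.V g) = c • D.α H' := by
    rw [act_apply, ℓ, polyActM_linPoly, inv_inv, ℓ, ← linPoly_smul] at hl
    ext1 i
    have := congrArg (pderiv i) hl
    rw [pderiv_linPoly, pderiv_linPoly] at this
    exact C_injective _ _ this
  have hp : D.pair H (D.gact D.V g f) = C c * D.act g (D.pair H' f) := by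
    rw [← pair_actv, gact_apply]
    simp only [pair_apply, cmul_apply, Finset.mul_sum]
    rw [Finset.sum_comm]
    refine Finset.sum_congr rfl fun j _ => ?_
    have h1 := congrArg (C : ℂ → Poly N) (congrFun hα j)
    simp only [Matrix.vecMul, dotProduct, Pi.smul_apply, smul_eq_mul, map_sum, map_mul] at h1
    simp only [← mul_assoc, ← h1, Finset.sum_mul]
  have hl' : D.act g (D.ℓ H') = C c⁻¹ * D.ℓ H := by
    have h1 := congrArg (D.act g) hl
    rw [← act_mul_apply, mul_inv_cancel, act_one_apply, map_mul, act_C] at h1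
    rw [h1, ← mul_assoc, ← C_mul, inv_mul_cancel₀ hc, C_1, one_mul]
  rw [hp]
  refine Dvd.dvd.mul_left ?_ _
  have h2 := map_dvd (D.act g) (hf H')
  rw [map_pow, hl', ha, mul_pow] at h2
  exact dvd_of_mul_left_dvd h2

/-- Reflections act on `f(α_H)` by the determinant. -/
lemma pair_gact {H : A} {s : G} (hs : s ∈ D.stab H) (f : Fin N → Poly N) :
    D.pair H (D.gact D.V s f) = C (D.χ s) * D.act s (D.pair H f) := by
  rw [gact_apply, D.pair_cmul_V hs, pair_actv]

/-- Invariant vector fields gain one order of tangency. -/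
lemma mem_vf_one_of_invariant {f : Fin N → Poly N} (hf : f ∈ D.vf 0)
    (hinv : ∀ g, D.gact D.V g f = f) : f ∈ D.vf 1 := by
  intro H
  obtain ⟨q, hq⟩ := hf H
  obtain ⟨s, hs, hdet⟩ := D.refl H
  have h1 := D.pair_gact hs f
  rw [hinv s, hq, add_zero, map_mul, D.act_ℓ_pow_a hs, mul_left_comm] at h1
  have h2 := mul_left_cancel₀ (pow_ne_zero _ (D.ℓ_ne_zero H)) h1
  have h3 : D.act s q = C (D.χ s)⁻¹ * q := by
    rw [h2, map_mul, act_C, ← mul_assoc]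
    have h4 := congrArg (D.act s) h2
    rw [map_mul, act_C] at h4
    rw [mul_assoc, ← h4, ← mul_assoc, ← C_mul, inv_mul_cancel₀ (D.χ_ne_zero s), C_1, one_mul]
  have h4 := D.ℓ_dvd_act_sub hs q
  have h5 : D.act s q - q = C ((D.χ s)⁻¹ - 1) * q := by rw [h3, C_sub, C_1]; ring
  have h6 : (D.χ s)⁻¹ - 1 ≠ 0 := fun h => hdet (inv_eq_one.1 (sub_eq_zero.1 h))
  rw [h5, ((IsUnit.mk0 _ h6).map C).dvd_mul_left] at h4
  rw [hq, pow_succ, add_zero]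
  exact mul_dvd_mul_left _ h4

/-- The divided difference of a vector field in `vf 1` along a reflection. -/
lemma exists_gact_sub {H : A} {s : G} (hs : s ∈ D.stab H) {f : Fin N → Poly N}
    (hf : f ∈ D.vf 1) : ∃ u ∈ D.vf 1, D.gact D.V s f - f = D.ℓ H • u := by
  obtain ⟨q, hq⟩ := hf H
  have hact : D.act s (D.ℓ H ^ (D.a H + 1)) = C (D.χ s)⁻¹ * D.ℓ H ^ (D.a H + 1) := by
    rw [pow_succ, map_mul, D.act_ℓ_pow_a hs, D.act_ℓ hs]; ring
  have hdvd : ∀ k, D.ℓ H ∣ (D.gact D.V s f - f) k := by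
    intro k
    obtain ⟨b, hb⟩ := (D.mem_stab H s).1 hs
    rw [gact_apply, hb, cmul_add_left, cmul_one]
    have h1 : (D.actv (Fin N) s f + cmul (Matrix.vecMulVec b (D.α H)) (D.actv (Fin N) s f) - f) k
        = (D.act s (f k) - f k) + C (b k) * D.act s (D.pair H f) := by
      rw [← pair_actv, ← cmul_vecMulVec]
      simp only [Pi.add_apply, Pi.sub_apply, actv_apply]
      ring
    rw [h1, hq, map_mul, hact]
    refine dvd_add (D.ℓ_dvd_act_sub hs _) (Dvd.dvd.mul_left (Dvd.dvd.mul_right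
      (Dvd.dvd.mul_left (dvd_pow_self _ (Nat.succ_ne_zero _)) _) _) _)
  obtain ⟨u, hu⟩ := exists_eq_smul_iff.2 hdvd
  refine ⟨u, fun H' => ?_, hu⟩
  have h1 : D.ℓ H * D.pair H' u = D.pair H' (D.gact D.V s f - f) := by
    rw [hu, map_smul, smul_eq_mul]
  by_cases hne : H' = H
  · subst hne
    have h2 : D.ℓ H' * D.pair H' u = D.ℓ H' * (D.ℓ H' ^ D.a H' * (D.act s q - q)) := by
      rw [h1, map_sub, D.pair_gact hs, hq, map_mul, hact, ← mul_assoc, ← mul_assoc, ← C_mul,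
        mul_inv_cancel₀ (D.χ_ne_zero s), C_1]
      ring
    rw [mul_left_cancel₀ (D.ℓ_ne_zero H') h2, pow_succ]
    exact mul_dvd_mul_left _ (D.ℓ_dvd_act_sub hs q)
  · have h2 := (D.vf 1).sub_mem (D.gact_mem_vf hf s) hf H'
    exact D.dvd_of_dvd_mul_ℓ hne (h1 ▸ h2)

/-- The homogeneous component of a vector field. -/
def hcv (k : ℕ) (f : Fin N → Poly N) : Fin N → Poly N := fun i => homogeneousComponent k (f i)

lemma dvd_homogeneousComponent {p q : Poly N} {k : ℕ} (hp : p.IsHomogeneous k) (h : p ∣ q)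
    (i : ℕ) : p ∣ homogeneousComponent i q := by
  obtain ⟨u, rfl⟩ := h
  rcases le_or_gt k i with hki | hki
  · obtain ⟨j, rfl⟩ := Nat.exists_eq_add_of_le hki
    rw [homogeneousComponent_mul hp]
    exact dvd_mul_right _ _
  · rw [homogeneousComponent_mul_of_lt hp hki]
    exact dvd_zero _

lemma hcv_mem_vf {f : Fin N → Poly N} (hf : f ∈ D.vf e) (k : ℕ) : hcv k f ∈ D.vf e := by
  intro H
  have h1 : D.pair H (hcv k f) = homogeneousComponent k (D.pair H f) := by
    simp [pair_apply, hcv, homogeneousComponent_C_mul]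
  rw [h1]
  refine dvd_homogeneousComponent (k := D.a H + e) ?_ (hf H) k
  simpa using (D.ℓ_isHomogeneous H).pow (D.a H + e)

lemma sum_hcv (f : Fin N → Poly N) : ∃ n, ∑ k ∈ Finset.range n, hcv k f = f := by
  refine ⟨(Finset.univ.sup fun i => (f i).totalDegree) + 1, ?_⟩
  ext1 i
  rw [Finset.sum_apply]
  conv_rhs => rw [← sum_homogeneousComponent (f i)]
  refine (Finset.sum_subset (Finset.range_mono ?_) fun k _ hk => ?_).symm
  · exact Nat.succ_le_succ (Finset.le_sup (f := fun i => (f i).totalDegree) (Finset.mem_univ i))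
  · exact homogeneousComponent_eq_zero _ _ (by simpa [Nat.lt_succ_iff] using hk)

/-- Averaging of vector fields over the group. -/
def avgv (f : Fin N → Poly N) : Fin N → Poly N := (Fintype.card G : ℂ)⁻¹ • ∑ g, D.gact D.V g f

lemma gact_avgv (g : G) (f : Fin N → Poly N) : D.gact D.V g (D.avgv f) = D.avgv f := by
  have h1 : ∀ h, D.gact D.V g (D.gact D.V h f) = D.gact D.V (g * h) f :=
    fun h => (D.gact_mul D.V g h f).symm
  rw [avgv, map_smul, map_sum]
  simp only [h1]
  rw [← Equiv.sum_comp (Equiv.mulLeft g) (fun h => D.gact D.V h f)]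
  rfl

lemma avgv_mem {P : Submodule ℂ (Fin N → Poly N)} {f : Fin N → Poly N}
    (h : ∀ g, D.gact D.V g f ∈ P) : D.avgv f ∈ P :=
  P.smul_mem _ (P.sum_mem fun g _ => h g)

lemma card_G_ne_zero : (Fintype.card G : ℂ) ≠ 0 := Nat.cast_ne_zero.2 Fintype.card_ne_zero

lemma avgv_sub (f : Fin N → Poly N) :
    D.avgv f - f = (Fintype.card G : ℂ)⁻¹ • ∑ g, (D.gact D.V g f - f) := by
  rw [Finset.sum_sub_distrib, smul_sub, ← avgv, Finset.sum_const, Finset.card_univ,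
    ← Nat.cast_smul_eq_nsmul ℂ, smul_smul, inv_mul_cancel₀ card_G_ne_zero, one_smul]

lemma avgv_add (f f' : Fin N → Poly N) : D.avgv (f + f') = D.avgv f + D.avgv f' := by
  simp [avgv, Finset.sum_add_distrib]

lemma avgv_smul_of_invariant {h : Poly N} (hh : ∀ g, D.act g h = h) (f : Fin N → Poly N) :
    D.avgv (h • f) = h • D.avgv f := by
  simp only [avgv, gact_smul, hh, ← Finset.smul_sum]
  rw [smul_comm]

lemma avgv_eq_of_invariant {f : Fin N → Poly N} (hf : ∀ g, D.gact D.V g f = f) :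
    D.avgv f = f := by
  rw [← sub_eq_zero, avgv_sub]
  simp [hf]

/-- The vector fields in `vf 1` that are invariant and homogeneous of degree `d`. -/
def IsBasic (d : ℕ) (L : Fin N → Poly N) : Prop :=
  L ∈ D.vf 1 ∧ (∀ g, D.gact D.V g L = L) ∧ ∀ i, (L i).IsHomogeneous d

lemma mem_span_basic_of_homogeneous (d : ℕ) : ∀ f ∈ D.vf 1, (∀ i, (f i).IsHomogeneous d) →
    f ∈ Submodule.span (Poly N) {L | ∃ d, D.IsBasic d L} := by
  set J := Submodule.span (Poly N) {L | ∃ d, D.IsBasic d L}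
  induction d using Nat.strong_induction_on with
  | _ d ih =>
    have hg : ∀ g, ∀ f ∈ D.vf 1, (∀ i, (f i).IsHomogeneous d) → D.gact D.V g f - f ∈ J := by
      intro g
      refine D.induction_on_gen (P := fun g => ∀ f ∈ D.vf 1, (∀ i, (f i).IsHomogeneous d) →
        D.gact D.V g f - f ∈ J) ?_ ?_ ?_ ?_ g
      · intro H s hs f hf hd
        obtain ⟨u, hu, hsu⟩ := D.exists_gact_sub hs hf
        have hhom : ∀ i, (D.ℓ H * u i).IsHomogeneous d := by
          intro i
          have h1 : D.ℓ H * u i = (D.gact D.V s f - f) i := by rw [hsu]; rfl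
          rw [h1]
          exact (D.gact_isHomogeneous hd s i).sub (hd i)
        rw [hsu]
        refine J.smul_mem _ ?_
        rcases Nat.eq_zero_or_pos d with rfl | hpos
        · have : u = 0 := by
            ext1 i
            by_contra h0
            have := le_of_isHomogeneous_mul (D.ℓ_isHomogeneous H) (D.ℓ_ne_zero H) h0 (hhom i)
            omega
          rw [this]
          exact J.zero_mem
        · exact ih (d - 1) (by omega) u hu fun i =>
            isHomogeneous_of_mul (D.ℓ_isHomogeneous H) (D.ℓ_ne_zero H) (hhom i)
      · intro f _ _
        rw [gact_one, sub_self]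
        exact J.zero_mem
      · intro g h hg hh f hf hd
        have := J.add_mem (hg _ (D.gact_mem_vf hf h) (D.gact_isHomogeneous hd h)) (hh f hf hd)
        rwa [← gact_mul, sub_add_sub_cancel] at this
      · intro g hg f hf hd
        have := J.neg_mem (hg _ (D.gact_mem_vf hf g⁻¹) (D.gact_isHomogeneous hd g⁻¹))
        rwa [← gact_mul, mul_inv_cancel, gact_one, neg_sub] at this
    intro f hf hd
    have h1 : D.avgv f ∈ J := by
      refine Submodule.subset_span ⟨d, ?_, fun g => D.gact_avgv g f, fun i => ?_⟩
      · exact D.avgv_mem (P := (D.vf 1).restrictScalars ℂ) fun g => D.gact_mem_vf hf g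
      · have := D.avgv_mem (f := f) (P := Submodule.pi Set.univ
          (fun _ : Fin N => homogeneousSubmodule (Fin N) ℂ d)) fun g i _ =>
            D.gact_isHomogeneous hd g i
        exact this i trivial
    have h2 : D.avgv f - f ∈ J := by
      rw [avgv_sub]
      exact (J.restrictScalars ℂ).smul_mem _
        ((J.restrictScalars ℂ).sum_mem fun g _ => hg g f hf hd)
    have := J.sub_mem h1 h2
    rwa [sub_sub_cancel] at this

lemma span_basic : Submodule.span (Poly N) {L | ∃ d, D.IsBasic d L} = D.vf 1 := by
  refine le_antisymm (Submodule.span_le.2 fun L ⟨d, hL⟩ => hL.1) fun f hf => ?_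
  obtain ⟨n, hn⟩ := sum_hcv f
  rw [← hn]
  exact Submodule.sum_mem _ fun k _ => D.mem_span_basic_of_homogeneous k _ (D.hcv_mem_vf hf k)
    fun i => homogeneousComponent_isHomogeneous _ _

/-- A homogeneous invariant generating family of size `k`. -/
def IsGen {k : ℕ} (L : Fin k → Fin N → Poly N) (d : Fin k → ℕ) : Prop :=
  (∀ i, D.IsBasic (d i) (L i)) ∧ D.vf 1 ≤ Submodule.span (Poly N) (Set.range L)

lemma exists_minimal_gen : ∃ k, (∃ (L : Fin k → Fin N → Poly N) (d : Fin k → ℕ), D.IsGen L d) ∧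
    ∀ k' < k, ∀ (L : Fin k' → Fin N → Poly N) (d : Fin k' → ℕ), ¬ D.IsGen L d := by
  have hex : ∃ k, ∃ (L : Fin k → Fin N → Poly N) (d : Fin k → ℕ), D.IsGen L d := by
    have hfg : (Submodule.span (Poly N) {L | ∃ d, D.IsBasic d L}).FG := IsNoetherian.noetherian _
    obtain ⟨s, hs, hspan⟩ := (Submodule.fg_span_iff_fg_span_finset_subset _).1 hfg
    have h1 : ∀ i : Fin s.card, ∃ d, D.IsBasic d (s.equivFin.symm i : Fin N → Poly N) :=
      fun i => hs (s.equivFin.symm i).2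
    choose d hd using h1
    refine ⟨s.card, fun i => (s.equivFin.symm i : Fin N → Poly N), d, hd, ?_⟩
    rw [← span_basic, hspan]
    refine Submodule.span_mono fun x hx => ⟨s.equivFin ⟨x, hx⟩, ?_⟩
    simp
  refine ⟨Nat.find hex, Nat.find_spec hex, fun k' hk' L d h => Nat.find_min hex hk' ⟨L, d, h⟩⟩

end ReflData

end ReflVF

namespace ReflVF

open scoped Classical

set_option linter.unusedSectionVars false

variable {N : ℕ} {G A : Type} [Group G] [Fintype G] [Fintype A]

/-- The homogeneous component of degree `k - m`, or zero if `k < m`. -/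
def shiftedComponent (k m : ℕ) (q : Poly N) : Poly N :=
  if m ≤ k then homogeneousComponent (k - m) q else 0

lemma shiftedComponent_isHomogeneous (k m : ℕ) (q : Poly N) :
    (shiftedComponent k m q).IsHomogeneous (k - m) := by
  rw [shiftedComponent]
  split_ifs
  · exact homogeneousComponent_isHomogeneous _ _
  · exact isHomogeneous_zero _ _ _

lemma shiftedComponent_eq_zero {k m : ℕ} (h : k < m) (q : Poly N) :
    shiftedComponent k m q = 0 := if_neg (not_le.2 h)

lemma homogeneousComponent_mul_eq {m : ℕ} {p : Poly N} (hp : p.IsHomogeneous m) (k : ℕ)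
    (q : Poly N) : homogeneousComponent k (q * p) = shiftedComponent k m q * p := by
  rw [mul_comm q, shiftedComponent]
  split_ifs with h
  · obtain ⟨j, rfl⟩ := Nat.exists_eq_add_of_le h
    rw [homogeneousComponent_mul hp, Nat.add_sub_cancel_left, mul_comm]
  · rw [homogeneousComponent_mul_of_lt hp (not_le.1 h), zero_mul]

lemma shiftedComponent_self (k : ℕ) (q : Poly N) :
    shiftedComponent k k q = C (constantCoeff q) := by
  rw [shiftedComponent, if_pos le_rfl, Nat.sub_self, homogeneousComponent_zero]
  rfl

namespace ReflData

lemma hcv_smul {m : ℕ} {f : Fin N → Poly N} (hf : ∀ i, (f i).IsHomogeneous m) (k : ℕ)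
    (q : Poly N) : hcv k (q • f) = shiftedComponent k m q • f := by
  ext1 i
  exact homogeneousComponent_mul_eq (hf i) k q

lemma hcv_sum {ι : Type*} (s : Finset ι) (k : ℕ) (f : ι → Fin N → Poly N) :
    hcv k (∑ i ∈ s, f i) = ∑ i ∈ s, hcv k (f i) := by
  ext1 i
  simp [hcv, Finset.sum_apply]

lemma hcv_eq_self {m : ℕ} {f : Fin N → Poly N} (hf : ∀ i, (f i).IsHomogeneous m) :
    hcv m f = f := by
  ext1 i
  simp [hcv, homogeneousComponent_of_mem (hf i)]

variable (D : ReflData N G A)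

lemma act_shiftedComponent (g : G) (k m : ℕ) (q : Poly N) :
    D.act g (shiftedComponent k m q) = shiftedComponent k m (D.act g q) := by
  rw [shiftedComponent, shiftedComponent]
  split_ifs
  · rw [homogeneousComponent_act]
  · rw [map_zero]

/-- The divided difference of a polynomial along a reflection. -/
lemma exists_act_sub {H : A} {s : G} (hs : s ∈ D.stab H) (p : Poly N) :
    ∃ u, D.act s p - p = D.ℓ H * u ∧ (u = 0 ∨ u.totalDegree < p.totalDegree) := by
  obtain ⟨u, hu⟩ := D.ℓ_dvd_act_sub hs p
  refine ⟨u, hu, or_iff_not_imp_left.2 fun h0 => ?_⟩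
  have h1 : (D.ℓ H * u).totalDegree = 1 + u.totalDegree := by
    rw [totalDegree_mul_of_isDomain (D.ℓ_ne_zero H) h0,
      (D.ℓ_isHomogeneous H).totalDegree (D.ℓ_ne_zero H)]
  have h2 : (D.act s p - p).totalDegree ≤ p.totalDegree :=
    (totalDegree_sub _ _).trans (max_le (D.totalDegree_act_le s p) le_rfl)
  rw [hu, h1] at h2
  omega

/-- Averaging of polynomials over the group. -/
def avg (p : Poly N) : Poly N := C (Fintype.card G : ℂ)⁻¹ * ∑ g, D.act g p

lemma act_avg (g : G) (p : Poly N) : D.act g (D.avg p) = D.avg p := by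
  have h1 : ∀ h, D.act g (D.act h p) = D.act (g * h) p := fun h => (D.act_mul_apply g h p).symm
  rw [avg, map_mul, act_C, map_sum]
  simp only [h1]
  rw [← Equiv.sum_comp (Equiv.mulLeft g) (fun h => D.act h p)]
  rfl

lemma avg_sub (p : Poly N) :
    D.avg p - p = C (Fintype.card G : ℂ)⁻¹ * ∑ g, (D.act g p - p) := by
  have h : C (Fintype.card G : ℂ)⁻¹ * (Fintype.card G : Poly N) = 1 := by
    rw [← map_natCast (C : ℂ →+* Poly N), ← C_mul, inv_mul_cancel₀ card_G_ne_zero, C_1]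
  rw [Finset.sum_sub_distrib, mul_sub, ← avg, Finset.sum_const, Finset.card_univ, nsmul_eq_mul,
    ← mul_assoc, h, one_mul]

lemma avg_mul_of_invariant {h : Poly N} (hh : ∀ g, D.act g h = h) (p : Poly N) :
    D.avg (p * h) = D.avg p * h := by
  simp only [avg, map_mul, hh, ← Finset.sum_mul, mul_assoc]

lemma avg_sum {ι : Type*} (s : Finset ι) (p : ι → Poly N) :
    D.avg (∑ i ∈ s, p i) = ∑ i ∈ s, D.avg (p i) := by
  simp only [avg, map_sum, ← Finset.mul_sum]
  rw [Finset.sum_comm]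

lemma avg_add (p q : Poly N) : D.avg (p + q) = D.avg p + D.avg q := by
  simp only [avg, map_add, Finset.sum_add_distrib, mul_add]

lemma avg_zero : D.avg 0 = 0 := by simp [avg]

/-- The Hilbert ideal: generated by the invariants without constant term. -/
def hilbertIdeal : Ideal (Poly N) :=
  Ideal.span {h | (∀ g, D.act g h = h) ∧ constantCoeff h = 0}

lemma act_mem_hilbertIdeal (g : G) {p : Poly N} (hp : p ∈ D.hilbertIdeal) :
    D.act g p ∈ D.hilbertIdeal := by
  have h1 : D.hilbertIdeal ≤ D.hilbertIdeal.comap (D.act g) := by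
    refine Ideal.span_le.2 fun h hh => ?_
    rw [SetLike.mem_coe, Ideal.mem_comap, hh.1 g]
    exact Ideal.subset_span hh
  exact h1 hp

lemma avg_sub_mem_hilbertIdeal {p : Poly N}
    (hp : ∀ H, ∀ s ∈ D.stab H, D.act s p - p ∈ D.hilbertIdeal) :
    D.avg p - p ∈ D.hilbertIdeal := by
  have h1 : ∀ g, D.act g p - p ∈ D.hilbertIdeal := by
    intro g
    refine D.induction_on_gen (P := fun g => D.act g p - p ∈ D.hilbertIdeal) hp ?_ ?_ ?_ g
    · rw [act_one_apply, sub_self]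
      exact Ideal.zero_mem _
    · intro g h hg hh
      have := add_mem (D.act_mem_hilbertIdeal g hh) hg
      rwa [map_sub, ← act_mul_apply, sub_add_sub_cancel] at this
    · intro g hg
      have := neg_mem (D.act_mem_hilbertIdeal g⁻¹ hg)
      rwa [map_sub, ← act_mul_apply, inv_mul_cancel, act_one_apply, neg_sub] at this
  rw [avg_sub]
  exact Ideal.mul_mem_left _ _ (sum_mem fun g _ => h1 g)

/-- Chevalley's lemma on relations between invariants. -/
lemma mem_hilbertIdeal_of_relation {ι : Type*} {T : Finset ι} {i : ι}
    {h : ι → Poly N} {e : ι → ℕ} (hinv : ∀ j g, D.act g (h j) = h j)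
    (hhom : ∀ j, (h j).IsHomogeneous (e j))
    (hnot : ¬ ∃ r : ι → Poly N, (∀ j g, D.act g (r j) = r j) ∧ h i = ∑ j ∈ T, r j * h j)
    (n : ℕ) : ∀ q : ι → Poly N, (q i).totalDegree < n → q i * h i + ∑ j ∈ T, q j * h j = 0 →
      q i ∈ D.hilbertIdeal := by
  induction n with
  | zero => intro q hq; omega
  | succ n ih =>
    intro q hq hrel
    have h1 : D.avg (q i) - q i ∈ D.hilbertIdeal := by
      refine D.avg_sub_mem_hilbertIdeal fun H s hs => ?_
      choose u hu hdeg using fun j => D.exists_act_sub hs (q j)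
      have h2 := congrArg (D.act s) hrel
      simp only [map_add, map_mul, map_sum, map_zero, hinv] at h2
      have h3 : D.ℓ H * (u i * h i + ∑ j ∈ T, u j * h j) = 0 := by
        rw [mul_add, Finset.mul_sum]
        simp only [← mul_assoc, ← hu, sub_mul, Finset.sum_sub_distrib]
        linear_combination h2 - hrel
      have h4 := (mul_eq_zero.1 h3).resolve_left (D.ℓ_ne_zero H)
      rw [hu]
      refine Ideal.mul_mem_left _ _ ?_
      rcases hdeg i with h0 | h0
      · rw [h0]; exact Ideal.zero_mem _
      · exact ih u (by omega) h4
    have h2 : D.avg (q i) * h i + ∑ j ∈ T, D.avg (q j) * h j = 0 := by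
      have := congrArg D.avg hrel
      rw [avg_add, avg_zero, avg_sum, D.avg_mul_of_invariant (hinv i)] at this
      rw [← this]
      exact congrArg _ (Finset.sum_congr rfl fun j _ => (D.avg_mul_of_invariant (hinv j) _).symm)
    have h3 : constantCoeff (D.avg (q i)) = 0 := by
      by_contra hc
      refine hnot ⟨fun j => C (-(constantCoeff (D.avg (q i)))⁻¹) *
        shiftedComponent (e i) (e j) (D.avg (q j)), fun j g => ?_, ?_⟩
      · rw [map_mul, act_C, act_shiftedComponent, act_avg]
      · have h4 := congrArg (homogeneousComponent (e i)) h2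
        rw [map_add, homogeneousComponent_mul_eq (hhom i), shiftedComponent_self, map_sum,
          map_zero] at h4
        simp only [homogeneousComponent_mul_eq (hhom _)] at h4
        simp only [mul_assoc, ← Finset.mul_sum]
        have h5 : (C (constantCoeff (D.avg (q i)))⁻¹ : Poly N) * C (constantCoeff (D.avg (q i)))
            = 1 := by rw [← C_mul, inv_mul_cancel₀ hc, C_1]
        rw [C_neg]
        linear_combination C (constantCoeff (D.avg (q i)))⁻¹ * h4 - h i * h5
    have h4 : D.avg (q i) ∈ D.hilbertIdeal := Ideal.subset_span ⟨fun g => D.act_avg g _, h3⟩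
    have := sub_mem h4 h1
    rwa [sub_sub_cancel] at this

lemma avgv_mem_vf_one {f : Fin N → Poly N} (hf : f ∈ D.vf 0) : D.avgv f ∈ D.vf 1 := by
  refine D.mem_vf_one_of_invariant ?_ fun g => D.gact_avgv g f
  exact D.avgv_mem (P := (D.vf 0).restrictScalars ℂ) fun g => D.gact_mem_vf hf g

lemma vf_one_le : D.vf 1 ≤ D.vf 0 := fun _ hf H =>
  (pow_dvd_pow _ (Nat.le_succ _)).trans (hf H)

lemma avgv_smul_mem {q : Poly N} (hq : q ∈ D.hilbertIdeal) : ∀ f ∈ D.vf 0,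
    D.avgv (q • f) ∈ RingHom.ker (constantCoeff : Poly N →+* ℂ) • D.vf 1 := by
  induction hq using Submodule.span_induction with
  | mem h hh =>
    intro f hf
    rw [D.avgv_smul_of_invariant hh.1]
    exact Submodule.smul_mem_smul hh.2 (D.avgv_mem_vf_one hf)
  | zero =>
    intro f _
    have : D.avgv 0 = 0 := by simp [avgv]
    rw [zero_smul, this]
    exact Submodule.zero_mem _
  | add x y _ _ hx hy =>
    intro f hf
    rw [add_smul, avgv_add]
    exact add_mem (hx f hf) (hy f hf)
  | smul s x _ hx =>
    intro f hf
    rw [smul_eq_mul, mul_comm, mul_smul]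
    exact hx _ ((D.vf 0).smul_mem s hf)

/-- There is no generating family with fewer than `k` elements. -/
def IsMinimalSize (k : ℕ) : Prop :=
  ∀ k' < k, ∀ (L : Fin k' → Fin N → Poly N) (d : Fin k' → ℕ), ¬ D.IsGen L d

variable {D}

lemma IsGen.span_eq {k : ℕ} {L : Fin k → Fin N → Poly N} {d : Fin k → ℕ} (hL : D.IsGen L d) :
    Submodule.span (Poly N) (Set.range L) = D.vf 1 := by
  refine le_antisymm (Submodule.span_le.2 ?_) hL.2
  rintro _ ⟨i, rfl⟩
  exact (hL.1 i).1

lemma IsMinimalSize.notMem {k : ℕ} (hk : D.IsMinimalSize k) {L : Fin k → Fin N → Poly N}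
    {d : Fin k → ℕ} (hL : D.IsGen L d) (i : Fin k) :
    L i ∉ RingHom.ker (constantCoeff : Poly N →+* ℂ) • D.vf 1 := by
  intro hmem
  rw [← hL.span_eq, Submodule.mem_ideal_smul_span_iff_exists_sum] at hmem
  obtain ⟨b, hb, hsum⟩ := hmem
  rw [Finsupp.sum_fintype _ (fun i c => c • L i) (fun _ => zero_smul _ _)] at hsum
  have h1 := congrArg (hcv (d i)) hsum
  rw [hcv_eq_self (hL.1 i).2.2, hcv_sum, ← Finset.add_sum_erase _ _ (Finset.mem_univ i)] at h1
  simp only [hcv_smul (hL.1 _).2.2] at h1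
  rw [shiftedComponent_self, show constantCoeff (b i) = 0 from hb i, C_0, zero_smul,
    zero_add] at h1
  obtain ⟨k', rfl⟩ : ∃ k', k = k' + 1 := ⟨k - 1, by have := i.2; omega⟩
  refine hk k' (Nat.lt_succ_self _) (L ∘ i.succAbove) (d ∘ i.succAbove)
    ⟨fun j => hL.1 _, hL.2.trans (Submodule.span_le.2 ?_)⟩
  have h2 : ∀ j, j ≠ i → L j ∈ Submodule.span (Poly N) (Set.range (L ∘ i.succAbove)) := by
    intro j hj
    obtain ⟨l, rfl⟩ := Fin.exists_succAbove_eq hj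
    exact Submodule.subset_span ⟨l, rfl⟩
  rintro _ ⟨j, rfl⟩
  by_cases hj : j = i
  · rw [hj, ← h1]
    exact Submodule.sum_mem _ fun l hl => Submodule.smul_mem _ _ (h2 l (Finset.ne_of_mem_erase hl))
  · exact h2 j hj

/-- Changing a generating family by an elementary transformation. -/
lemma IsGen.add_smul {k : ℕ} {L : Fin k → Fin N → Poly N} {d : Fin k → ℕ} (hL : D.IsGen L d)
    {i : Fin k} {r : Fin k → Poly N} (hri : r i = 0) (hinv : ∀ j g, D.act g (r j) = r j)
    (hhom : ∀ j, ∀ l, (r j * L i l).IsHomogeneous (d j)) :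
    D.IsGen (fun j => L j + r j • L i) d := by
  refine ⟨fun j => ⟨?_, fun g => ?_, fun l => ?_⟩, ?_⟩
  · exact add_mem (hL.1 j).1 ((D.vf 1).smul_mem _ (hL.1 i).1)
  · rw [map_add, gact_smul, (hL.1 j).2.1, (hL.1 i).2.1, hinv]
  · exact ((hL.1 j).2.2 l).add (hhom j l)
  · refine hL.2.trans (Submodule.span_le.2 ?_)
    have hsub : ∀ j, L j + r j • L i ∈
        Submodule.span (Poly N) (Set.range fun j => L j + r j • L i) :=
      fun j => Submodule.subset_span ⟨j, rfl⟩
    rintro _ ⟨j, rfl⟩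
    have hi := hsub i
    rw [hri, zero_smul, add_zero] at hi
    have := sub_mem (hsub j) (Submodule.smul_mem _ (r j) hi)
    rwa [add_sub_cancel_right] at this

lemma IsMinimalSize.eq_zero_of_graded_relation (hN : 0 < N) {k : ℕ} (hk : D.IsMinimalSize k)
    (c : ℕ) (T : Finset (Fin k)) :
    ∀ (L : Fin k → Fin N → Poly N) (d : Fin k → ℕ), D.IsGen L d → ∀ p : Fin k → Poly N,
      (∀ i g, D.act g (p i) = p i) → (∀ i, (p i).IsHomogeneous (c - d i)) →
      (∀ i, c < d i → p i = 0) → (∀ i ∉ T, p i = 0) → ∑ i, p i • L i = 0 → ∀ i, p i = 0 := by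
  induction T using Finset.induction_on with
  | empty => intro L d _ p _ _ _ hT _ i; exact hT i (Finset.notMem_empty i)
  | insert i T hiT ih =>
    intro L d hL p hinv hhom hlt hT hrel
    by_cases hpi : p i = 0
    · refine ih L d hL p hinv hhom hlt (fun j hj => ?_) hrel
      by_cases hji : j = i
      · rw [hji, hpi]
      · exact hT j (by simp [hji, hj])
    by_cases hr : ∃ r : Fin k → Poly N, (∀ j g, D.act g (r j) = r j) ∧ p i = ∑ j ∈ T, r j * p j
    · obtain ⟨r, hrinv, hr⟩ := hr
      have hdi : d i ≤ c := not_lt.1 fun h => hpi (hlt i h)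
      set r' : Fin k → Poly N := fun j =>
        if j ∈ T ∧ d j ≤ c then shiftedComponent (d j) (d i) (r j) else 0 with hr'
      have hpi' : p i = ∑ j ∈ T, r' j * p j := by
        have h1 := congrArg (homogeneousComponent (c - d i)) hr
        rw [homogeneousComponent_of_mem (hhom i), if_pos rfl, map_sum] at h1
        rw [h1]
        refine Finset.sum_congr rfl fun j hj => ?_
        rw [homogeneousComponent_mul_eq (hhom j), hr']
        simp only [hj, true_and]
        split_ifs with hjc
        · congr 1
          rw [shiftedComponent, shiftedComponent]
          congr 1
          · exact propext (by omega)
          · congr 2; omega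
        · rw [hlt j (not_le.1 hjc), mul_zero, mul_zero]
      have hL' : D.IsGen (fun j => L j + r' j • L i) d := by
        refine hL.add_smul (by simp [hr', hiT]) (fun j g => ?_) fun j l => ?_
        · simp only [hr']
          split_ifs
          · rw [act_shiftedComponent, hrinv]
          · rw [map_zero]
        · simp only [hr']
          split_ifs
          · rcases le_or_gt (d i) (d j) with h | h
            · have := (shiftedComponent_isHomogeneous (d j) (d i) (r j)).mul ((hL.1 i).2.2 l)
              rwa [Nat.sub_add_cancel h] at this
            · rw [shiftedComponent_eq_zero h, zero_mul]
              exact isHomogeneous_zero _ _ _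
          · rw [zero_mul]
            exact isHomogeneous_zero _ _ _
      have hz := ih _ d hL' (Function.update p i 0) (fun j g => ?_) (fun j => ?_) (fun j hj => ?_)
        (fun j hj => ?_) ?_
      · refine absurd ?_ hpi
        rw [hpi']
        refine Finset.sum_eq_zero fun j hj => ?_
        have := hz j
        rw [Function.update_of_ne (ne_of_mem_of_not_mem hj hiT)] at this
        rw [this, mul_zero]
      · rcases eq_or_ne j i with rfl | hji
        · simp
        · rw [Function.update_of_ne hji, hinv]
      · rcases eq_or_ne j i with rfl | hji
        · simpa using isHomogeneous_zero _ _ _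
        · rw [Function.update_of_ne hji]; exact hhom j
      · rcases eq_or_ne j i with rfl | hji
        · simp
        · rw [Function.update_of_ne hji]; exact hlt j hj
      · rcases eq_or_ne j i with rfl | hji
        · simp
        · rw [Function.update_of_ne hji]; exact hT j (by simp [hji, hj])
      · have h1 : ∀ j, Function.update p i 0 j • (L j + r' j • L i) =
            p j • L j + (if j ∈ T then r' j * p j else 0) • L i - if j = i then p i • L i else 0 := by
          intro j
          rcases eq_or_ne j i with rfl | hji
          · simp [hiT]
          · rw [Function.update_of_ne hji, if_neg hji, sub_zero, smul_add, smul_smul]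
            split_ifs with hj
            · rw [mul_comm]
            · rw [hT j (by simp [hji, hj]), zero_mul]
        simp only [h1, Finset.sum_sub_distrib, Finset.sum_add_distrib, hrel, ← Finset.sum_smul]
        rw [Finset.sum_ite_mem, Finset.univ_inter, ← hpi']
        simp
    · exfalso
      refine hk.notMem hL i ?_
      obtain ⟨F, hF, hF0, hFspan⟩ := D.exists_good_basis hN
      have h1 : ∀ j, ∃ q : Fin N → Poly N, L j = ∑ m, q m • F m := fun j =>
        hFspan (L j) fun H => D.vf_one_le (hL.1 j).1 H
      choose q hq using h1
      have h2 : ∀ m, ∑ j, q j m * p j = 0 := by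
        have h3 : Matrix.vecMul (fun m => ∑ j, q j m * p j) F = 0 := by
          have h4 : ∑ j, p j • L j = ∑ m, (∑ j, q j m * p j) • F m := by
            simp only [hq, Finset.smul_sum, Finset.sum_smul, smul_smul]
            rw [Finset.sum_comm]
            simp only [mul_comm]
          rw [hrel] at h4
          rw [h4]
          ext1 l
          simp [Matrix.vecMul, dotProduct, Finset.sum_apply]
        exact congrFun (Matrix.eq_zero_of_vecMul_eq_zero hF h3)
      have h3 : ∀ m, q i m ∈ D.hilbertIdeal := by
        intro m
        refine D.mem_hilbertIdeal_of_relation (T := T) (i := i) hinv hhom hr _ (fun j => q j m)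
          (Nat.lt_succ_self _) ?_
        rw [← h2 m, ← Finset.sum_insert (f := fun j => q j m * p j) hiT]
        refine Finset.sum_subset (Finset.subset_univ _) fun j _ hj => ?_
        rw [hT j hj, mul_zero]
      have h4 : D.avgv (L i) = ∑ m, D.avgv (q i m • F m) := by
        conv_lhs => rw [hq i]
        simp only [avgv, map_sum, ← Finset.smul_sum]
        rw [Finset.sum_comm]
      rw [← D.avgv_eq_of_invariant (hL.1 i).2.1, h4]
      exact Submodule.sum_mem _ fun m _ => D.avgv_smul_mem (h3 m) _ (hF0 m)

lemma IsMinimalSize.eq_zero_of_relation (hN : 0 < N) {k : ℕ} (hk : D.IsMinimalSize k)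
    {L : Fin k → Fin N → Poly N} {d : Fin k → ℕ} (hL : D.IsGen L d) (n : ℕ) :
    ∀ p : Fin k → Poly N, (∀ i, p i = 0 ∨ (p i).totalDegree < n) → ∑ i, p i • L i = 0 →
      p = 0 := by
  induction n with
  | zero => exact fun p hp _ => funext fun i => (hp i).resolve_right (Nat.not_lt_zero _)
  | succ n ih =>
    intro p hp hrel
    have hinv : ∀ g, ∀ i, D.act g (p i) = p i := by
      intro g
      refine D.induction_on_gen (P := fun g => ∀ i, D.act g (p i) = p i) ?_ ?_ ?_ ?_ g
      · intro H s hs i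
        choose u hu hdeg using fun j => D.exists_act_sub hs (p j)
        have h1 : u = 0 := by
          refine ih u (fun j => ?_) ?_
          · rcases hdeg j with h | h
            · exact Or.inl h
            · rcases hp j with h' | h'
              · rw [h'] at h; simp at h
              · right; omega
          · have h2 := congrArg (D.gact D.V s) hrel
            simp only [map_sum, map_zero, gact_smul, (hL.1 _).2.1] at h2
            have h3 : D.ℓ H • ∑ j, u j • L j = 0 := by
              simp only [Finset.smul_sum, smul_smul, ← hu, sub_smul, Finset.sum_sub_distrib]
              rw [h2, hrel, sub_zero]
            exact (smul_eq_zero.1 h3).resolve_left (D.ℓ_ne_zero H)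
        have := hu i
        rwa [h1, Pi.zero_apply, mul_zero, sub_eq_zero] at this
      · exact fun i => D.act_one_apply _
      · intro g h hg hh i
        rw [act_mul_apply, hh, hg]
      · intro g hg i
        conv_lhs => rw [← hg i]
        rw [← act_mul_apply, inv_mul_cancel, act_one_apply]
    have h1 : ∀ c i, shiftedComponent c (d i) (p i) = 0 := by
      intro c
      refine hk.eq_zero_of_graded_relation hN c Finset.univ L d hL _ (fun i g => ?_) (fun i => ?_)
        (fun i hi => ?_) (fun i hi => absurd (Finset.mem_univ i) hi) ?_
      · rw [act_shiftedComponent, hinv]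
      · exact shiftedComponent_isHomogeneous _ _ _
      · exact shiftedComponent_eq_zero hi _
      · have h2 := congrArg (hcv c) hrel
        rw [hcv_sum] at h2
        simp only [hcv_smul (hL.1 _).2.2] at h2
        rw [h2]
        ext1 i
        simp [hcv]
    ext1 i
    refine eq_of_homogeneousComponent fun j => ?_
    have := h1 (j + d i) i
    rwa [shiftedComponent, if_pos (Nat.le_add_left _ _), Nat.add_sub_cancel,
      ← map_zero (homogeneousComponent j)] at this

lemma IsMinimalSize.linearIndependent (hN : 0 < N) {k : ℕ} (hk : D.IsMinimalSize k)
    {L : Fin k → Fin N → Poly N} {d : Fin k → ℕ} (hL : D.IsGen L d) {p : Fin k → Poly N}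
    (hp : ∑ i, p i • L i = 0) : p = 0 :=
  hk.eq_zero_of_relation hN hL ((Finset.univ.sup fun i => (p i).totalDegree) + 1) p
    (fun i => Or.inr (Nat.lt_succ_of_le
      (Finset.le_sup (f := fun i => (p i).totalDegree) (Finset.mem_univ i)))) hp

end ReflData

end ReflVF

namespace ReflVF

open scoped Classical

set_option linter.unusedSectionVars false

variable {N : ℕ} {G A : Type} [Group G] [Fintype G] [Fintype A]

lemma det_isHomogeneous_of_rows {κ : Type*} [Fintype κ] [DecidableEq κ] {X : Matrix κ κ (Poly N)} {d : κ → ℕ}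
    (hX : ∀ i j, (X i j).IsHomogeneous (d i)) : X.det.IsHomogeneous (∑ i, d i) := by
  rw [Matrix.det_apply']
  refine IsHomogeneous.sum _ _ _ fun σ _ => ?_
  have h1 : (∏ i, X (σ i) i).IsHomogeneous (∑ i, d (σ i)) :=
    IsHomogeneous.prod _ _ _ fun i _ => hX (σ i) i
  rw [Equiv.sum_comp σ d] at h1
  have h2 := (isHomogeneous_C (Fin N) ((σ.sign : ℤ) : ℂ)).mul h1
  simpa using h2

namespace ReflData

variable (D : ReflData N G A)

/-- The product of all `ℓ_H ^ (a_H + 1)`. -/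
def Q : Poly N := ∏ H, D.ℓ H ^ (D.a H + 1)

/-- The product of all `ℓ_H' ^ (a_H' + 1)` with `H' ≠ H`. -/
def Qc (H : A) : Poly N := ∏ H' ∈ Finset.univ.erase H, D.ℓ H' ^ (D.a H' + 1)

lemma Q_eq (H : A) : D.Q = D.ℓ H ^ (D.a H + 1) * D.Qc H :=
  (Finset.mul_prod_erase _ _ (Finset.mem_univ H)).symm

lemma Q_ne_zero : D.Q ≠ 0 := D.prod_pow_ne_zero fun H => D.a H + 1

lemma Q_smul_mem (f : Fin N → Poly N) : D.Q • f ∈ D.vf 1 := by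
  intro H
  rw [map_smul, Q_eq D H]
  exact Dvd.dvd.mul_right (dvd_mul_right _ _) _

lemma not_ℓ_dvd_Qc_pow (H : A) (k : ℕ) : ¬ D.ℓ H ∣ D.Qc H ^ k := by
  intro h
  obtain ⟨H', hH', h'⟩ := (D.ℓ_prime H).exists_mem_finset_dvd ((D.ℓ_prime H).dvd_of_dvd_pow h)
  exact D.not_ℓ_dvd (Finset.ne_of_mem_erase hH').symm ((D.ℓ_prime H).dvd_of_dvd_pow h')

variable {D}

lemma IsMinimalSize.eq_dim (hN : 0 < N) {k : ℕ} (hk : D.IsMinimalSize k)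
    {L : Fin k → Fin N → Poly N} {d : Fin k → ℕ} (hL : D.IsGen L d) : k = N := by
  rw [← Fintype.card_fin k]
  refine (le_antisymm ?_ ?_).trans (Fintype.card_fin N)
  · refine card_le_of_injective (Poly N) (Fintype.linearCombination (Poly N) L)
      (LinearMap.ker_eq_bot.1 (LinearMap.ker_eq_bot'.2 fun p hp => ?_))
    rw [Fintype.linearCombination_apply] at hp
    exact hk.linearIndependent hN hL hp
  · have h1 : ∀ j : Fin N, ∃ c : Fin k → Poly N, ∑ i, c i • L i = D.Q • Pi.single j 1 := fun j =>
      (Submodule.mem_span_range_iff_exists_fun _).1 (hL.2 (D.Q_smul_mem _))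
    choose c hc using h1
    refine card_le_of_injective (Poly N) (Fintype.linearCombination (Poly N) c)
      (LinearMap.ker_eq_bot.1 (LinearMap.ker_eq_bot'.2 fun p hp => ?_))
    rw [Fintype.linearCombination_apply] at hp
    have h2 : ∑ j, p j • D.Q • (Pi.single j 1 : Fin N → Poly N) = 0 := by
      have h3 : ∑ i, (∑ j, p j • c j) i • L i = 0 := by
        rw [hp]; simp only [Pi.zero_apply, zero_smul, Finset.sum_const_zero]
      rw [← h3]
      simp only [← hc, Finset.smul_sum, Finset.sum_apply, Finset.sum_smul, Pi.smul_apply,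
        smul_smul, smul_eq_mul]
      rw [Finset.sum_comm]
    ext1 j
    have h3 := congrFun h2 j
    simp only [Finset.sum_apply, Pi.smul_apply, smul_eq_mul, Pi.single_apply, mul_ite, mul_one,
      mul_zero, Finset.sum_ite_eq, Finset.mem_univ, if_true, Pi.zero_apply] at h3
    exact (mul_eq_zero.1 h3).resolve_right D.Q_ne_zero

lemma ℓ_pow_dvd_det {L : Matrix (Fin N) (Fin N) (Poly N)} (hL : ∀ i, L i ∈ D.vf 1) (H : A) :
    D.ℓ H ^ (D.a H + 1) ∣ L.det := by
  obtain ⟨j, hj⟩ := Function.ne_iff.1 (D.α_ne H)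
  have h1 := congrFun (congrArg (fun M => Matrix.mulVec M fun i => C (D.α H i))
    (Matrix.adjugate_mul L)) j
  simp only [← Matrix.mulVec_mulVec, Matrix.smul_mulVec, Matrix.one_mulVec, Pi.smul_apply,
    smul_eq_mul] at h1
  rw [← ((IsUnit.mk0 _ hj).map (C : ℂ →+* Poly N)).dvd_mul_right, ← h1]
  have h3 : ∀ k, D.ℓ H ^ (D.a H + 1) ∣ Matrix.mulVec L (fun i => C (D.α H i)) k := by
    intro k
    have h2 := hL k H
    rw [pair_apply] at h2
    simpa only [Matrix.mulVec, dotProduct, mul_comm] using h2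
  change _ ∣ ∑ k, L.adjugate j k * Matrix.mulVec L (fun i => C (D.α H i)) k
  exact Finset.dvd_sum fun k _ => (h3 k).mul_left _

lemma IsGen.det_dvd {L : Matrix (Fin N) (Fin N) (Poly N)} {d : Fin N → ℕ} (hL : D.IsGen L d)
    {P : Matrix (Fin N) (Fin N) (Poly N)} (hP : ∀ i, P i ∈ D.vf 1) : L.det ∣ P.det := by
  have h1 : ∀ j, ∃ c : Fin N → Poly N, ∑ i, c i • L i = P j := fun j =>
    (Submodule.mem_span_range_iff_exists_fun _).1 (hL.2 (hP j))
  choose c hc using h1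
  have h2 : P = Matrix.of c * L := by
    ext1 j l
    rw [← hc]
    simp [Matrix.mul_apply, Finset.sum_apply]
  rw [h2, Matrix.det_mul]
  exact dvd_mul_left _ _

lemma IsGen.det_dvd_Q_pow {L : Matrix (Fin N) (Fin N) (Poly N)} {d : Fin N → ℕ}
    (hL : D.IsGen L d) : L.det ∣ D.Q ^ N := by
  have := hL.det_dvd (P := D.Q • 1) fun i => D.Q_smul_mem _
  rwa [Matrix.det_smul, Matrix.det_one, mul_one, Fintype.card_fin] at this

lemma IsGen.det_dvd_Qc_pow_mul {L : Matrix (Fin N) (Fin N) (Poly N)} {d : Fin N → ℕ}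
    (hL : D.IsGen L d) (H : A) : L.det ∣ D.Qc H ^ N * D.ℓ H ^ (D.a H + 1) := by
  obtain ⟨j, hj⟩ := Function.ne_iff.1 (D.α_ne H)
  set b : Fin N → Poly N := Pi.single j (C (D.α H j)⁻¹) with hb
  have hαb : D.pair H b = 1 := by
    rw [pair_apply, Finset.sum_eq_single j]
    · rw [hb, Pi.single_eq_same, ← C_mul, mul_inv_cancel₀ hj, C_1]
    · intro i _ hij
      rw [hb, Pi.single_eq_of_ne hij, mul_zero]
    · exact fun h => absurd (Finset.mem_univ _) h
  have h1 := hL.det_dvd (P := D.Qc H • (1 + Matrix.vecMulVec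
    (fun i => (D.ℓ H ^ (D.a H + 1) - 1) * C (D.α H i)) b)) ?_
  · have h2 : (1 + Matrix.vecMulVec (fun i => (D.ℓ H ^ (D.a H + 1) - 1) * C (D.α H i)) b).det =
        D.ℓ H ^ (D.a H + 1) := by
      rw [Matrix.vecMulVec_eq Unit, Matrix.det_one_add_replicateCol_mul_replicateRow]
      have h3 : b ⬝ᵥ (fun i => (D.ℓ H ^ (D.a H + 1) - 1) * C (D.α H i)) =
          (D.ℓ H ^ (D.a H + 1) - 1) * D.pair H b := by
        rw [pair_apply, dotProduct, Finset.mul_sum]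
        exact Finset.sum_congr rfl fun i _ => by ring
      rw [h3, hαb]
      ring
    rwa [Matrix.det_smul, h2, Fintype.card_fin] at h1
  · intro i H'
    have h2 : (D.Qc H • (1 + Matrix.vecMulVec
        (fun i => (D.ℓ H ^ (D.a H + 1) - 1) * C (D.α H i)) b)) i = D.Qc H •
        (Pi.single i 1 + ((D.ℓ H ^ (D.a H + 1) - 1) * C (D.α H i)) • b) := by
      ext1 l
      simp [Matrix.vecMulVec_apply, Matrix.one_apply, Pi.single_apply, eq_comm]
    rw [h2, map_smul, smul_eq_mul]
    by_cases hne : H' = H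
    · subst hne
      have h3 : D.pair H' (Pi.single i 1) = C (D.α H' i) := by
        rw [pair_apply]
        simp [Pi.single_apply]
      rw [map_add, map_smul, hαb, h3, smul_eq_mul]
      exact Dvd.intro (D.Qc H' * C (D.α H' i)) (by ring)
    · refine Dvd.dvd.mul_right ?_ _
      exact Finset.dvd_prod_of_mem (fun H => D.ℓ H ^ (D.a H + 1))
        (Finset.mem_erase.2 ⟨hne, Finset.mem_univ _⟩)

lemma IsGen.sum_degrees {L : Matrix (Fin N) (Fin N) (Poly N)} {d : Fin N → ℕ}
    (hL : D.IsGen L d) (hdet : L.det ≠ 0) : ∑ i, d i = ∑ H, (D.a H + 1) := by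
  obtain ⟨u, hu⟩ : D.Q ∣ L.det :=
    D.prod_dvd (fun H => D.a H + 1) fun H => ℓ_pow_dvd_det (fun i => (hL.1 i).1) H
  have hu0 : u ≠ 0 := by
    rintro rfl
    exact hdet (by rw [hu, mul_zero])
  have hunit : IsUnit u := by
    by_contra hnu
    obtain ⟨π, hπ, hπu⟩ := WfDvdMonoid.exists_irreducible_factor hnu hu0
    have h1 : π ∣ D.Q ^ N := (hπu.trans (Dvd.intro_left _ hu.symm)).trans hL.det_dvd_Q_pow
    obtain ⟨H, -, hH⟩ := hπ.prime.exists_mem_finset_dvd (hπ.prime.dvd_of_dvd_pow h1)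
    have h2 : D.ℓ H ∣ u := ((hπ.dvd_symm (D.ℓ_prime H).irreducible
      (hπ.prime.dvd_of_dvd_pow hH))).trans hπu
    have h3 : D.ℓ H ^ (D.a H + 1) * D.ℓ H ∣ D.ℓ H ^ (D.a H + 1) * D.Qc H ^ N := by
      rw [mul_comm _ (D.Qc H ^ N)]
      refine dvd_trans ?_ (hL.det_dvd_Qc_pow_mul H)
      rw [hu, D.Q_eq H, mul_assoc]
      exact mul_dvd_mul_left _ (Dvd.dvd.mul_left h2 _)
    exact D.not_ℓ_dvd_Qc_pow H N
      ((mul_dvd_mul_iff_left (pow_ne_zero _ (D.ℓ_ne_zero H))).1 h3)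
  have h1 := (det_isHomogeneous_of_rows fun i j => (hL.1 i).2.2 j).totalDegree hdet
  rw [hu, totalDegree_mul_of_isDomain D.Q_ne_zero hu0,
    (isUnit_iff_totalDegree_of_isReduced.1 hunit).2] at h1
  have h2 := (D.prod_pow_isHomogeneous fun H => D.a H + 1).totalDegree D.Q_ne_zero
  rw [← h1, add_zero]
  exact h2

variable (D)

theorem exists_basic_basis (hN : 0 < N) : ∃ (L : Fin N → Fin N → Poly N) (d : Fin N → ℕ),
    (∀ i, D.IsBasic (d i) (L i)) ∧ ∑ i, d i = ∑ H, (D.a H + 1) ∧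
    (∀ f ∈ D.vf 1, ∃ c : Fin N → Poly N, ∑ i, c i • L i = f) ∧
    ∀ c : Fin N → Poly N, ∑ i, c i • L i = 0 → c = 0 := by
  obtain ⟨k, ⟨L, d, hL⟩, hk⟩ := D.exists_minimal_gen
  obtain rfl : k = N := IsMinimalSize.eq_dim hN hk hL
  have hind : ∀ c : Fin k → Poly k, ∑ i, c i • L i = 0 → c = 0 :=
    fun c hc => IsMinimalSize.linearIndependent hN hk hL hc
  refine ⟨L, d, hL.1, IsGen.sum_degrees (L := L) hL fun h0 => ?_,
    fun f hf => (Submodule.mem_span_range_iff_exists_fun _).1 (hL.2 hf), hind⟩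
  obtain ⟨v, hv0, hv⟩ := Matrix.exists_vecMul_eq_zero_iff.2 h0
  refine hv0 (hind v ?_)
  rw [← hv]
  ext1 l
  simp [Matrix.vecMul, dotProduct, Finset.sum_apply]

end ReflData

end ReflVF

namespace ReflVF

lemma applyVF_linPoly {N : ℕ} (f : Fin N → Poly N) (a : Fin N → ℂ) :
    applyVF f (linPoly a) = ∑ i, C (a i) * f i := by
  simp only [applyVF, pderiv_linPoly, mul_comm]

lemma applyVF_mul {N : ℕ} (f : Fin N → Poly N) (p q : Poly N) :
    applyVF f (p * q) = p * applyVF f q + q * applyVF f p := by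
  simp only [applyVF, Derivation.leibniz, smul_eq_mul, Finset.mul_sum, mul_add,
    Finset.sum_add_distrib]
  congr 1 <;> exact Finset.sum_congr rfl fun i _ => by ring

lemma applyVF_add {N : ℕ} (f : Fin N → Poly N) (p q : Poly N) :
    applyVF f (p + q) = applyVF f p + applyVF f q := by
  simp only [applyVF, map_add, mul_add, Finset.sum_add_distrib]

lemma applyVF_C {N : ℕ} (f : Fin N → Poly N) (c : ℂ) : applyVF f (C c) = 0 := by
  simp [applyVF]

lemma linPoly_single {N : ℕ} (i : Fin N) : linPoly (Pi.single i 1) = X i := by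
  simp [linPoly, Pi.single_apply]

lemma eq_one_add_vecMulVec {N : ℕ} {M : Matrix (Fin N) (Fin N) ℂ} {a : Fin N → ℂ} (ha : a ≠ 0) :
    (∀ v : Fin N → ℂ, ∑ i, a i * v i = 0 → M.mulVec v = v) ↔
      ∃ b, M = 1 + Matrix.vecMulVec b a := by
  constructor
  · intro h
    obtain ⟨j, hj⟩ := Function.ne_iff.1 ha
    set w : Fin N → ℂ := Pi.single j (a j)⁻¹ with hw
    have hwa : a ⬝ᵥ w = 1 := by
      rw [hw, dotProduct_single, mul_inv_cancel₀ hj]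
    refine ⟨M.mulVec w - w, Matrix.mulVec_injective (funext fun v => ?_)⟩
    have h1 : M.mulVec (v - (a ⬝ᵥ v) • w) = v - (a ⬝ᵥ v) • w := by
      refine h _ ?_
      change a ⬝ᵥ (v - (a ⬝ᵥ v) • w) = 0
      rw [dotProduct_sub, dotProduct_smul, hwa, smul_eq_mul, mul_one, sub_self]
    rw [Matrix.mulVec_sub, Matrix.mulVec_smul, sub_eq_iff_eq_add] at h1
    rw [h1, Matrix.add_mulVec, Matrix.one_mulVec, Matrix.vecMulVec_mulVec, op_smul_eq_smul,
      smul_sub]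
    abel
  · rintro ⟨b, rfl⟩ v hv
    have hv' : a ⬝ᵥ v = 0 := hv
    rw [Matrix.add_mulVec, Matrix.one_mulVec, Matrix.vecMulVec_mulVec, hv', op_smul_eq_smul,
      zero_smul, add_zero]

lemma det_ne_one_of_isOfFinOrder {N : ℕ} {g : Matrix.GeneralLinearGroup (Fin N) ℂ}
    (hg : IsOfFinOrder g) (hr : IsReflection g) {a b : Fin N → ℂ}
    (h : (g : Matrix (Fin N) (Fin N) ℂ) = 1 + Matrix.vecMulVec b a) :
    (g : Matrix (Fin N) (Fin N) ℂ).det ≠ 1 := by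
  intro hdet
  have h0 : a ⬝ᵥ b = 0 := by
    rw [h, Matrix.vecMulVec_eq Unit, Matrix.det_one_add_replicateCol_mul_replicateRow] at hdet
    simpa using hdet
  have h1 : ∀ k : ℕ, (1 + Matrix.vecMulVec b a) ^ k = 1 + (k : ℂ) • Matrix.vecMulVec b a := by
    intro k
    induction k with
    | zero => simp
    | succ k ih =>
      rw [pow_succ, ih, mul_add, mul_one, add_mul, one_mul, Matrix.smul_mul,
        Matrix.vecMulVec_mul_vecMulVec, h0]
      simp [add_smul, add_assoc]
  obtain ⟨k, hk, hgk⟩ := hg.exists_pow_eq_one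
  have h2 := congrArg (Units.val) hgk
  rw [Units.val_pow_eq_pow_val, h, h1, Units.val_one, add_eq_left, smul_eq_zero] at h2
  have h3 := h2.resolve_left (Nat.cast_ne_zero.2 hk.ne')
  rw [IsReflection, h, h3, add_zero, sub_self, Matrix.rank_zero] at hr
  exact zero_ne_one hr

namespace ReflData

variable {N : ℕ} {G A : Type} [Group G] (D : ReflData N G A)

lemma act_applyVF_act {f : Fin N → Poly N} {g : G} (hf : D.gact D.V g f = f) (p : Poly N) :
    D.act g (applyVF f (D.act g⁻¹ p)) = applyVF f p := by
  induction p using MvPolynomial.induction_on with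
  | C c => rw [act_C, applyVF_C, map_zero]
  | add p q hp hq => rw [map_add, applyVF_add, map_add, hp, hq, applyVF_add]
  | mul_X p i hp =>
    have hX : D.act g (applyVF f (D.act g⁻¹ (X i))) = applyVF f (X i) := by
      rw [← linPoly_single, D.act_apply g⁻¹, polyActM_linPoly, inv_inv, applyVF_linPoly,
        applyVF_linPoly, Matrix.single_one_vecMul, map_sum]
      have h1 := congrFun hf i
      simp only [gact_apply, cmul_apply, actv_apply] at h1
      simpa [Pi.single_apply] using h1
    rw [map_mul, applyVF_mul, map_add, map_mul, map_mul, hp, hX, applyVF_mul,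
      ← act_mul_apply, ← act_mul_apply, mul_inv_cancel, act_one_apply, act_one_apply]

end ReflData

end ReflVF

/-- the `S`-module `D_m` is free with a basis of `N` homogeneous `W`-invariant
vector fields `L^{(1)},…,L^{(N)}` of degrees `d_1,…,d_N` with
`Σ d_k = Σ_{H ∈ 𝒜} (m_H n_H + 1)`. -/
theorem stmt_6 (N : ℕ) (hN : 0 < N)
    -- `W` is an irreducible finite complex reflection group
    (W : Subgroup (Matrix.GeneralLinearGroup (Fin N) ℂ)) (hWfin : Finite W)
    (hgen : Subgroup.closure {g | g ∈ W ∧ IsReflection g} = W)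
    (hirr : ∀ U : Submodule ℂ (Fin N → ℂ),
      (∀ g ∈ W, ∀ v ∈ U, (↑g : Matrix (Fin N) (Fin N) ℂ).mulVec v ∈ U) → U = ⊥ ∨ U = ⊤)
    -- `𝒜` is the (finite) set of reflection hyperplanes of `W`, `H = ker α_H`
    (A : Type) (hAfin : Fintype A)
    (α : A → (Fin N → ℂ)) (hα : ∀ H, α H ≠ 0)
    -- distinct indices give distinct hyperplanes
    (hdistinct : ∀ H H', (∃ c : ℂ, α H' = c • α H) → H = H')
    -- every reflection hyperplane of `W` is the kernel of some `α_H`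
    (hcomplete : ∀ g ∈ W, IsReflection g → ∃ H, ∀ v : Fin N → ℂ,
      ((↑g : Matrix (Fin N) (Fin N) ℂ).mulVec v = v ↔ ∑ i, α H i * v i = 0))
    -- every `H ∈ 𝒜` is a reflection hyperplane
    (hrefl : ∀ H, ∃ g ∈ W, IsReflection g ∧ ∀ v : Fin N → ℂ,
      (∑ i, α H i * v i) = 0 → (↑g : Matrix (Fin N) (Fin N) ℂ).mulVec v = v)
    -- `n_H` is the order of the pointwise stabilizer `W_H`
    (n : A → ℕ)
    (hnstab : ∀ H, n H = Nat.card {g : W | ∀ v : Fin N → ℂ,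
      (∑ i, α H i * v i) = 0 →
        (↑(g : Matrix.GeneralLinearGroup (Fin N) ℂ) : Matrix (Fin N) (Fin N) ℂ).mulVec v = v})
    -- `m` is a `W`-invariant multiplicity function
    (m : A → ℕ)
    (hminv : ∀ g ∈ W, ∀ H, ∃ H', (∃ c : ℂ, c ≠ 0 ∧
        α H' = c • Matrix.vecMul (α H) (↑(g⁻¹) : Matrix (Fin N) (Fin N) ℂ)) ∧ m H' = m H) :
    ∃ (L : Fin N → (Fin N → MvPolynomial (Fin N) ℂ)) (d : Fin N → ℕ),
      -- each `L^{(k)}` belongs to `D_m`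
      (∀ k H, linPoly (α H) ^ (m H * n H + 1) ∣ applyVF (L k) (linPoly (α H))) ∧
      -- each `L^{(k)}` is `W`-invariant
      (∀ k, ∀ g ∈ W, ∀ p, polyAct g (applyVF (L k) (polyAct g⁻¹ p)) = applyVF (L k) p) ∧
      -- each `L^{(k)}` is homogeneous of degree `d_k`
      (∀ k i, L k i = 0 ∨ (L k i).IsHomogeneous (d k)) ∧
      -- `Σ d_k = Σ_H (m_H n_H + 1)`
      ((∑ k, d k) = ∑ H : A, (m H * n H + 1)) ∧
      -- the `L^{(k)}` generate `D_m` over `S`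
      (∀ f : Fin N → MvPolynomial (Fin N) ℂ,
        (∀ H, linPoly (α H) ^ (m H * n H + 1) ∣ applyVF f (linPoly (α H))) →
        ∃ c : Fin N → MvPolynomial (Fin N) ℂ, ∀ i, f i = ∑ k, c k * L k i) ∧
      -- and they are independent over `S`
      (∀ c : Fin N → MvPolynomial (Fin N) ℂ,
        (∀ i, (∑ k, c k * L k i) = 0) → ∀ k, c k = 0) := by
  classical
  let _ : Fintype W := Fintype.ofFinite W
  have hst : ∀ H (s : W), (∀ v : Fin N → ℂ, (∑ i, α H i * v i) = 0 →
      (↑(s : Matrix.GeneralLinearGroup (Fin N) ℂ) : Matrix (Fin N) (Fin N) ℂ).mulVec v = v) ↔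
      ∃ b, (↑(s : Matrix.GeneralLinearGroup (Fin N) ℂ) : Matrix (Fin N) (Fin N) ℂ) =
        1 + Matrix.vecMulVec b (α H) := fun H s => ReflVF.eq_one_add_vecMulVec (hα H)
  let D : ReflVF.ReflData N W A :=
    { V := (Units.coeHom _).comp W.subtype
      α := α
      α_ne := hα
      distinct := hdistinct
      stab := fun H =>
        { carrier := {g : W | ∀ v : Fin N → ℂ, (∑ i, α H i * v i) = 0 →
            (↑(g : Matrix.GeneralLinearGroup (Fin N) ℂ) : Matrix (Fin N) (Fin N) ℂ).mulVec v = v}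
          one_mem' := fun v _ => Matrix.one_mulVec v
          mul_mem' := fun {g h} hg hh v hv => by
            rw [Subgroup.coe_mul, Units.val_mul, ← Matrix.mulVec_mulVec, hh v hv, hg v hv]
          inv_mem' := fun {g} hg v hv => by
            conv_lhs => rw [← hg v hv]
            rw [Matrix.mulVec_mulVec, ← Units.val_mul, ← Subgroup.coe_mul, inv_mul_cancel]
            exact Matrix.one_mulVec v }
      mem_stab := hst
      m := m
      perm := fun g H => by
        obtain ⟨H', ⟨c, hc, h⟩, hm⟩ := hminv g g.2 H
        exact ⟨H', c, hc, h, hm⟩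
      refl := fun H => by
        obtain ⟨g, hg, hr, hfix⟩ := hrefl H
        refine ⟨⟨g, hg⟩, hfix, ?_⟩
        obtain ⟨b, hb⟩ := (hst H ⟨g, hg⟩).1 hfix
        exact ReflVF.det_ne_one_of_isOfFinOrder
          (W.subtype.isOfFinOrder (isOfFinOrder_of_finite (⟨g, hg⟩ : W))) hr hb
      gen := by
        rw [eq_top_iff]
        intro x _
        have hle : Subgroup.closure {g | g ∈ W ∧ IsReflection g} ≤
            (Subgroup.closure {s : W | ∃ H, ∀ v : Fin N → ℂ, (∑ i, α H i * v i) = 0 →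
              (↑(s : Matrix.GeneralLinearGroup (Fin N) ℂ) :
                Matrix (Fin N) (Fin N) ℂ).mulVec v = v}).map W.subtype := by
          rw [Subgroup.closure_le]
          rintro g ⟨hg, hr⟩
          obtain ⟨H, hH⟩ := hcomplete g hg hr
          exact ⟨⟨g, hg⟩, Subgroup.subset_closure ⟨H, fun v hv => (hH v).2 hv⟩, rfl⟩
        obtain ⟨y, hy, hyx⟩ := hle (hgen.ge x.2)
        rw [← W.subtype_injective hyx]
        exact hy
      irr := fun U hU => hirr U fun g hg v hv => hU ⟨g, hg⟩ v hv }
  have ha : ∀ H, D.a H = m H * n H := fun H => by rw [hnstab]; rfl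
  have hmem : ∀ f, f ∈ D.vf 1 ↔
      ∀ H, linPoly (α H) ^ (m H * n H + 1) ∣ applyVF f (linPoly (α H)) := by
    intro f
    refine forall_congr' fun H => ?_
    rw [ha, ReflVF.applyVF_linPoly, ReflVF.ReflData.pair_apply]
    rfl
  obtain ⟨L, d, hL, hsum, hgenL, hind⟩ := D.exists_basic_basis hN
  refine ⟨L, d, fun k => (hmem _).1 (hL k).1, fun k g hg p => ?_, fun k i => Or.inr ((hL k).2.2 i),
    ?_, fun f hf => ?_, fun c hc => congrFun (hind c ?_)⟩
  · exact D.act_applyVF_act ((hL k).2.1 ⟨g, hg⟩) p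
  · simpa only [ha] using hsum
  · obtain ⟨c, hc⟩ := hgenL f ((hmem f).2 hf)
    refine ⟨c, fun i => ?_⟩
    rw [← hc]
    simp [Finset.sum_apply]
  · ext1 i
    refine Eq.trans ?_ (hc i)
    simp [Finset.sum_apply]

end
end

section
/- For polynomials f_1,…,f_N ∈ S, the element φ = Σ_{i=1}^N f_i ⊗ e_i ∈ S ⊗ V belongs to the vector-valued quasi-invariants 𝐐_m(V) if and only if the vector field L = Σ_{i=1}^N f_i ∂_{x_i} belongs to D̃_m. Consequently the map ρ(Σ f_i ⊗ e_i) = Σ f_i ∂_{x_i} is an isomorphism of S-modules from 𝐐_m(V) onto D̃_m, and ρ is W-equivariant for the diagonal W-action on S ⊗ V and the action (w·L)(p) = w·(L(w⁻¹·p)) on vector fields. -/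
open MvPolynomial

noncomputable section

/-- The matrix of the idempotent-type element `e_{H,j} = Σ_{w ∈ W_H} (det w)^j w`
acting on `V = ℂ^N`, where `W_H = ⟨s_H⟩` is cyclic of order `n_H`. -/
def eMatrix {N : ℕ} (sH : Matrix.GeneralLinearGroup (Fin N) ℂ) (nH j : ℕ) :
    Matrix (Fin N) (Fin N) ℂ :=
  ∑ k ∈ Finset.range nH,
    ((↑sH : Matrix (Fin N) (Fin N) ℂ).det ^ (j * k)) • ((↑sH : Matrix (Fin N) (Fin N) ℂ) ^ k)

namespace Matrix

variable {ι R : Type*} [Fintype ι] [DecidableEq ι] [CommRing R]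

theorem det_one_sub_vecMulVec (c a : ι → R) :
    (1 - vecMulVec c a).det = 1 - a ⬝ᵥ c := by
  rw [sub_eq_add_neg, ← neg_vecMulVec, vecMulVec_eq Unit,
    det_one_add_replicateCol_mul_replicateRow, dotProduct_neg, ← sub_eq_add_neg]

theorem smul_one_sub_vecMulVec_pow (c a : ι → R) (k : ℕ) :
    (a ⬝ᵥ c) • (1 - vecMulVec c a) ^ k
      = (a ⬝ᵥ c) • 1 - (1 - (1 - a ⬝ᵥ c) ^ k) • vecMulVec c a := by
  induction k with
  | zero => simp
  | succ k ih =>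
    have hP : vecMulVec c a * vecMulVec c a = (a ⬝ᵥ c) • vecMulVec c a := by
      rw [vecMulVec_mul_vecMulVec, vecMulVec_smul]
    rw [pow_succ, ← smul_mul_assoc, ih, mul_sub, mul_one, sub_mul, smul_mul_assoc, one_mul,
      smul_mul_assoc, hP, smul_smul]
    module

end Matrix

theorem IsPrimitiveRoot.sum_pow_mul_eq_zero {R : Type*} [CommRing R] [IsDomain R] {ζ : R} {n : ℕ}
    (h : IsPrimitiveRoot ζ n) {j : ℕ} (hj : ¬ n ∣ j) :
    ∑ k ∈ Finset.range n, ζ ^ (j * k) = 0 := by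
  have hne : 1 - ζ ^ j ≠ 0 := fun h0 => hj ((h.pow_eq_one_iff_dvd j).1 (sub_eq_zero.1 h0).symm)
  have hmul := mul_neg_geom_sum (ζ ^ j) n
  rw [← pow_mul, mul_comm j n, pow_mul, h.pow_eq_one, one_pow, sub_self] at hmul
  simpa only [pow_mul] using (mul_eq_zero.1 hmul).resolve_left hne

namespace MvPolynomial

theorem pderiv_aeval {R σ τ : Type*} [CommRing R] [Fintype σ] (y : σ → MvPolynomial τ R) (i : τ)
    (p : MvPolynomial σ R) :
    pderiv i (aeval y p) = ∑ l, pderiv i (y l) * aeval y (pderiv l p) := by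
  classical
  induction p using MvPolynomial.induction_on with
  | C r => simp
  | add p q hp hq => simp only [map_add, hp, hq, mul_add, Finset.sum_add_distrib]
  | mul_X p j hp =>
    simp only [map_mul, Derivation.leibniz, hp, aeval_X, smul_eq_mul, map_add, mul_add,
      Finset.sum_add_distrib, Finset.mul_sum, pderiv_X]
    congr 1
    · rw [Finset.sum_eq_single j (fun l _ hl => by simp [hl.symm]) (by simp)]
      simp [mul_comm]
    · exact Finset.sum_congr rfl fun l _ => by ring

end MvPolynomial

theorem eMatrix_eq {N : ℕ} {s : Matrix.GeneralLinearGroup (Fin N) ℂ} {n : ℕ} {a c : Fin N → ℂ}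
    (hs : (↑s : Matrix (Fin N) (Fin N) ℂ) = 1 - Matrix.vecMulVec c a)
    (hdet : IsPrimitiveRoot (↑s : Matrix (Fin N) (Fin N) ℂ).det n) {j : ℕ} (hj : ¬ n ∣ j) :
    (a ⬝ᵥ c) • eMatrix s n j
      = (∑ k ∈ Finset.range n, (↑s : Matrix (Fin N) (Fin N) ℂ).det ^ ((j + 1) * k)) •
          Matrix.vecMulVec c a := by
  have hd : (↑s : Matrix (Fin N) (Fin N) ℂ).det = 1 - a ⬝ᵥ c := by
    rw [hs, Matrix.det_one_sub_vecMulVec]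
  have hzero := hdet.sum_pow_mul_eq_zero hj
  have hterm : ∀ k, (a ⬝ᵥ c) • ((↑s : Matrix (Fin N) (Fin N) ℂ).det ^ (j * k)
        • (↑s : Matrix (Fin N) (Fin N) ℂ) ^ k)
      = (↑s : Matrix (Fin N) (Fin N) ℂ).det ^ (j * k) • ((a ⬝ᵥ c) • 1 - Matrix.vecMulVec c a)
        + (↑s : Matrix (Fin N) (Fin N) ℂ).det ^ ((j + 1) * k) • Matrix.vecMulVec c a := by
    intro k
    rw [smul_comm, hs, Matrix.smul_one_sub_vecMulVec_pow, ← hs, ← hd, add_one_mul, pow_add]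
    module
  rw [eMatrix, Finset.smul_sum, Finset.sum_congr rfl fun k _ => hterm k, Finset.sum_add_distrib,
    ← Finset.sum_smul, ← Finset.sum_smul, hzero, zero_smul, zero_add]

theorem dvd_eMatrix_iff {N : ℕ} {s : Matrix.GeneralLinearGroup (Fin N) ℂ} {n : ℕ} (hn : 2 ≤ n)
    {a c : Fin N → ℂ} (hc : c ≠ 0)
    (hs : (↑s : Matrix (Fin N) (Fin N) ℂ) = 1 - Matrix.vecMulVec c a)
    (hdet : IsPrimitiveRoot (↑s : Matrix (Fin N) (Fin N) ℂ).det n)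
    (q : MvPolynomial (Fin N) ℂ) (f : Fin N → MvPolynomial (Fin N) ℂ) :
    (∀ j : ℕ, 1 ≤ j → j ≤ n - 1 → ∀ l, q ∣ ∑ i, C (eMatrix s n j l i) * f i)
      ↔ q ∣ ∑ i, C (a i) * f i := by
  have hac : a ⬝ᵥ c ≠ 0 := by
    intro h0
    apply hdet.ne_one hn
    rw [hs, Matrix.det_one_sub_vecMulVec, h0, sub_zero]
  have hsum : ∀ j, 1 ≤ j → j ≤ n - 1 → ∀ l,
      C (a ⬝ᵥ c) * ∑ i, C (eMatrix s n j l i) * f i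
        = C ((∑ k ∈ Finset.range n, (↑s : Matrix (Fin N) (Fin N) ℂ).det ^ ((j + 1) * k)) * c l)
          * ∑ i, C (a i) * f i := by
    intro j hj1 hj2 l
    have hj : ¬ n ∣ j := Nat.not_dvd_of_pos_of_lt hj1 (by omega)
    rw [Finset.mul_sum, Finset.mul_sum]
    refine Finset.sum_congr rfl fun i _ => ?_
    have he := congrFun (congrFun (eMatrix_eq hs hdet hj) l) i
    simp only [Matrix.smul_apply, Matrix.vecMulVec_apply, smul_eq_mul] at he
    rw [← mul_assoc, ← mul_assoc, ← C_mul, ← C_mul, he, mul_assoc]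
  have hunit : ∀ {r : ℂ}, r ≠ 0 → IsUnit (C r : MvPolynomial (Fin N) ℂ) :=
    fun hr => (isUnit_iff_ne_zero.2 hr).map C
  constructor
  · intro h
    obtain ⟨l, hl⟩ := Function.ne_iff.1 hc
    have hn0 : (n : ℂ) ≠ 0 := Nat.cast_ne_zero.2 (by omega)
    have hlast := hsum (n - 1) (by omega) le_rfl l
    rw [Nat.sub_add_cancel (by omega : 1 ≤ n)] at hlast
    simp only [pow_mul, hdet.pow_eq_one, one_pow, Finset.sum_const, Finset.card_range,
      nsmul_eq_mul, mul_one] at hlast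
    rw [← (hunit (mul_ne_zero hn0 hl)).dvd_mul_left, ← hlast]
    exact (h (n - 1) (by omega) le_rfl l).mul_left _
  · intro h j hj1 hj2 l
    rw [← (hunit hac).dvd_mul_left, hsum j hj1 hj2 l]
    exact h.mul_left _

theorem polyActM_polyActM {N : ℕ} (M M' : Matrix (Fin N) (Fin N) ℂ) (p : MvPolynomial (Fin N) ℂ) :
    polyActM M (polyActM M' p) = polyActM (M' * M) p := by
  unfold polyActM
  rw [← AlgHom.comp_apply, comp_aeval]
  congr 2
  funext i
  simp only [map_sum, map_mul, aeval_X, algHom_C, algebraMap_eq, Finset.mul_sum, Matrix.mul_apply,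
    Finset.sum_mul]
  rw [Finset.sum_comm]
  exact Finset.sum_congr rfl fun _ _ => Finset.sum_congr rfl fun _ _ => (mul_assoc _ _ _).symm

theorem polyActM_one {N : ℕ} (p : MvPolynomial (Fin N) ℂ) : polyActM 1 p = p := by
  have h : (fun i : Fin N => ∑ j, C ((1 : Matrix (Fin N) (Fin N) ℂ) i j) * X j)
      = (X : Fin N → MvPolynomial (Fin N) ℂ) := by
    funext i
    rw [Finset.sum_eq_single i (fun j _ hj => by simp [Matrix.one_apply_ne hj.symm]) (by simp)]
    simp
  rw [polyActM, h, aeval_X_left_apply]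

theorem polyAct_polyAct_inv {N : ℕ} (g : Matrix.GeneralLinearGroup (Fin N) ℂ)
    (p : MvPolynomial (Fin N) ℂ) : polyAct g (polyAct g⁻¹ p) = p := by
  rw [polyAct, polyAct, polyActM_polyActM, inv_inv, ← Units.val_mul, mul_inv_cancel, Units.val_one,
    polyActM_one]

theorem pderiv_polyActM {N : ℕ} (M : Matrix (Fin N) (Fin N) ℂ) (i : Fin N)
    (p : MvPolynomial (Fin N) ℂ) :
    pderiv i (polyActM M p) = ∑ l, C (M l i) * polyActM M (pderiv l p) := by
  unfold polyActM
  rw [pderiv_aeval]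
  refine Finset.sum_congr rfl fun l _ => ?_
  congr 1
  rw [map_sum, Finset.sum_eq_single i
    (fun j _ hj => by simp [pderiv_X_of_ne hj]) (by simp)]
  simp

theorem polyAct_applyVF {N : ℕ} (g : Matrix.GeneralLinearGroup (Fin N) ℂ)
    (f : Fin N → MvPolynomial (Fin N) ℂ) (p : MvPolynomial (Fin N) ℂ) :
    polyAct g (applyVF f (polyAct g⁻¹ p))
      = applyVF (fun l => ∑ i, C ((↑g : Matrix (Fin N) (Fin N) ℂ) l i) * polyAct g (f i)) p := by
  have hsum : ∀ h : Fin N → MvPolynomial (Fin N) ℂ, polyAct g (∑ i, h i) = ∑ i, polyAct g (h i) :=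
    fun h => map_sum (aeval _) h _
  have hmul : ∀ q r, polyAct g (q * r) = polyAct g q * polyAct g r := fun q r => map_mul (aeval _) q r
  have hC : ∀ r, polyAct g (C r) = C r := fun r => aeval_C _ r
  have hder : ∀ i, polyAct g (pderiv i (polyAct g⁻¹ p))
      = ∑ l, C ((↑g : Matrix (Fin N) (Fin N) ℂ) l i) * pderiv l p := by
    intro i
    rw [polyAct.eq_def g⁻¹ p, pderiv_polyActM, hsum]
    refine Finset.sum_congr rfl fun l _ => ?_
    rw [hmul, hC, ← polyAct, polyAct_polyAct_inv, inv_inv]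
  simp only [applyVF, hsum, hmul, hder, Finset.mul_sum, Finset.sum_mul]
  rw [Finset.sum_comm]
  exact Finset.sum_congr rfl fun _ _ => Finset.sum_congr rfl fun _ _ => by ring

/-- `φ = Σ f_i ⊗ e_i ∈ S ⊗ V` lies in `𝐐_m(V)` iff the vector field
`L = Σ f_i ∂_i` lies in `D̃_m`; hence `ρ(Σ f_i ⊗ e_i) = Σ f_i ∂_i` is an `S`-module
isomorphism `𝐐_m(V) ≅ D̃_m`, and `ρ` is `W`-equivariant for the diagonal action on
`S ⊗ V` and the action `(w·L)(p) = w·(L(w⁻¹·p))` on vector fields. An element of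
`S ⊗ V` is encoded by its component vector `f : Fin N → S`; the `l`-th component of
`(1 ⊗ e_{H,j})(φ)` is `Σ_i (e_{H,j})_{l i} f_i`, and the `l`-th component of the diagonal
action of `w` is `Σ_i w_{l i} (w·f_i)`. -/
theorem stmt_7 (N : ℕ) (hN : 0 < N)
    (W : Subgroup (Matrix.GeneralLinearGroup (Fin N) ℂ)) (hWfin : Finite W)
    (A : Type)
    (s : A → Matrix.GeneralLinearGroup (Fin N) ℂ) (hsW : ∀ H, s H ∈ W)
    (n : A → ℕ) (hn2 : ∀ H, 2 ≤ n H) (horder : ∀ H, orderOf (s H) = n H)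
    (hdet : ∀ H, orderOf ((↑(s H) : Matrix (Fin N) (Fin N) ℂ).det) = n H)
    (α : A → (Fin N → ℂ)) (hα : ∀ H, α H ≠ 0)
    (αv : A → (Fin N → ℂ)) (hαv : ∀ H, αv H ≠ 0)
    (hform : ∀ H (v : Fin N → ℂ),
      (↑(s H) : Matrix (Fin N) (Fin N) ℂ).mulVec v = v - (∑ i, α H i * v i) • αv H)
    (m : A → ℕ) :
    -- membership criterion: `φ ∈ 𝐐_m(V)` iff `ρ(φ) ∈ D̃_m`
    (∀ f : Fin N → MvPolynomial (Fin N) ℂ,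
      (∀ H, ∀ j : ℕ, 1 ≤ j → j ≤ n H - 1 → ∀ l,
        linPoly (α H) ^ (m H * n H) ∣ ∑ i, MvPolynomial.C (eMatrix (s H) (n H) j l i) * f i)
      ↔ (∀ H, linPoly (α H) ^ (m H * n H) ∣ ∑ i, MvPolynomial.C (α H i) * f i)) ∧
    -- `W`-equivariance of `ρ`: `ρ(w·φ) = w·ρ(φ)`
    (∀ g ∈ W, ∀ f : Fin N → MvPolynomial (Fin N) ℂ, ∀ p : MvPolynomial (Fin N) ℂ,
      polyAct g (applyVF f (polyAct g⁻¹ p))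
        = applyVF
            (fun l => ∑ i, MvPolynomial.C ((↑g : Matrix (Fin N) (Fin N) ℂ) l i) *
              polyAct g (f i)) p) := by
  have hs : ∀ H, (↑(s H) : Matrix (Fin N) (Fin N) ℂ) = 1 - Matrix.vecMulVec (αv H) (α H) := by
    intro H
    refine Matrix.ext_of_mulVec_single fun i => ?_
    rw [hform, Matrix.sub_mulVec, Matrix.one_mulVec, Matrix.vecMulVec_mulVec, op_smul_eq_smul]
    rfl
  refine ⟨fun f => forall_congr' fun H => ?_, fun g _ f p => polyAct_applyVF g f p⟩
  exact dvd_eMatrix_iff (hn2 H) (hαv H) (hs H) (hdet H ▸ IsPrimitiveRoot.orderOf _) _ f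


end
end
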